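/- For every ε > 0 there exists K > 0 such that for every odd prime power q, every subset E ⊆ F_q² with |E| ≥ K·q^{3/2}, and all a, b ∈ F_q with a ≠ 0 and b ≠ 0, the number N of triples (x,y,z) ∈ E × E × E with ‖x−y‖ = a and ‖x−z‖ = b satisfies |N − |E|³/q²| ≤ ε·|E|³/q². -/

import Mathlib

/-- The norm `‖x‖ = x₁² + x₂²` on `F_q²`. -/
def fnorm {F : Type*} [Field F] (x : Fin 2 → F) : F := x 0 ^ 2 + x 1 ^ 2

section

open Polynomial

theorem kl_ndeg {F : Type*} [Field F] {P : F[X]} {k : ℕ} (hk : 0 < k) (h : P.degree < k) :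
    P.natDegree < k := by
  by_cases h0 : P = 0
  · subst h0; simpa using hk
  · exact (natDegree_lt_iff_degree_lt h0).mpr h

theorem kl_sq_aux {F : Type*} [Field F] (G : F[X]) (hG : Squarefree G) (hdeg : 0 < G.natDegree)
    (k : F) (hk : k ≠ 0) (P R : F[X]) (h : P ^ 2 = C k * G * R ^ 2) : P = 0 ∧ R = 0 := by
  by_cases hR : R = 0
  · subst hR
    simp at h
    exact ⟨h, rfl⟩
  exfalso
  have hG0 : G ≠ 0 := hG.ne_zero
  have hGu : ¬ IsUnit G := by
    intro hu
    rw [natDegree_eq_zero_of_isUnit hu] at hdeg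
    exact lt_irrefl _ hdeg
  obtain ⟨p, hp, hpG⟩ := WfDvdMonoid.exists_irreducible_factor hGu hG0
  have hpp : Prime p := hp.prime
  have hP : P ≠ 0 := by
    rintro rfl
    have : C k * G * R ^ 2 ≠ 0 := by
      apply mul_ne_zero (mul_ne_zero _ hG0) (pow_ne_zero _ hR)
      simpa using hk
    apply this
    rw [← h]; simp
  have h1 : emultiplicity p (P^2) = emultiplicity p (C k * G * R ^ 2) := by rw [h]
  rw [emultiplicity_mul hpp, emultiplicity_mul hpp, emultiplicity_pow hpp, emultiplicity_pow hpp] at h1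
  have hCk : emultiplicity p (C k) = 0 := by
    rw [emultiplicity_eq_zero]
    intro hd
    exact hp.not_isUnit (isUnit_of_dvd_unit hd (isUnit_C.mpr hk.isUnit))
  have hpG1 : emultiplicity p G = 1 := by
    apply le_antisymm
    · rcases (squarefree_iff_emultiplicity_le_one G).mp hG p with h | h
      · exact h
      · exact absurd h hp.not_isUnit
    · have := le_emultiplicity_of_pow_dvd (a := p) (b := G) (k := 1) (by simpa using hpG)
      simpa using this
  have fP : FiniteMultiplicity p P := FiniteMultiplicity.of_prime_left hpp hP
  have fR : FiniteMultiplicity p R := FiniteMultiplicity.of_prime_left hpp hR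
  rw [hCk, hpG1, fP.emultiplicity_eq_multiplicity, fR.emultiplicity_eq_multiplicity] at h1
  norm_cast at h1
  omega

section
variable {F : Type*} [Field F] [Fintype F]

noncomputable def klG (c : F) : F[X] := (X ^ Fintype.card F - X) ^ 2 - C c

theorem klG_natDegree (c : F) : (klG c).natDegree = 2 * Fintype.card F := by
  have h1 : 1 < Fintype.card F := Fintype.one_lt_card
  have h2 : ((X ^ Fintype.card F - X : F[X]) ^ 2).natDegree = 2 * Fintype.card F := by
    rw [natDegree_pow, FiniteField.X_pow_card_sub_X_natDegree_eq F h1]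
  unfold klG
  rw [natDegree_sub_C, h2]

theorem kl_two_ne (hq : Odd (Fintype.card F)) : (2 : F) ≠ 0 := by
  intro h
  have := FiniteField.even_card_iff_char_two (F := F)
  have h3 : ringChar F = 2 := by
    have : ringChar F ∣ 2 := by
      apply ringChar.dvd; exact_mod_cast h
    rcases (Nat.dvd_prime Nat.prime_two).mp this with h | h
    · exact absurd h CharP.ringChar_ne_one
    · exact h
  rw [this] at h3
  obtain ⟨k, hk⟩ := hq
  omega

theorem klG_squarefree (hq : Odd (Fintype.card F)) (c : F) (hc : c ≠ 0) : Squarefree (klG c) := by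
  apply Separable.squarefree
  have h2 := kl_two_ne (F := F) hq
  have hd : derivative (klG c) = - (2 * (X ^ Fintype.card F - X)) := by
    unfold klG
    simp [derivative_pow]
    left; exact map_ofNat C 2
  rw [Polynomial.Separable, hd]
  refine ⟨-C c⁻¹, -C c⁻¹ * C (2⁻¹) * (X ^ Fintype.card F - X), ?_⟩
  unfold klG
  have e1 : (C c⁻¹ * C c : F[X]) = 1 := by rw [← C_mul, inv_mul_cancel₀ hc, C_1]
  have e2 : (C 2⁻¹ * 2 : F[X]) = 1 := by
    have : (2 : F[X]) = C 2 := (map_ofNat C 2).symm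
    rw [this, ← C_mul, inv_mul_cancel₀ h2, C_1]
  linear_combination e1 + (C c⁻¹ * (X ^ Fintype.card F - X)^2) * e2

theorem kl_expand (m : ℕ) (P : F[X]) : expand F (Fintype.card F ^ m) P = P ^ (Fintype.card F ^ m) := by
  induction m generalizing P with
  | zero => simp
  | succ m ih =>
    rw [pow_succ, expand_mul, FiniteField.expand_card, ih, ← pow_mul, mul_comm]

noncomputable def klPhi (r l J N : ℕ) (T : F[X])  :
    ((Fin J → degreeLT F (l + N)) × (Fin J → degreeLT F l)) →ₗ[F] F[X] where
  toFun v := ∑ j : Fin J, (expand F r (v.1 j : F[X]) + expand F r (v.2 j : F[X]) * T) * X ^ (j : ℕ)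
  map_add' v w := by
    rw [← Finset.sum_add_distrib]
    apply Finset.sum_congr rfl
    intro j _
    simp
    ring
  map_smul' a v := by
    simp only [RingHom.id_apply]
    rw [Finset.smul_sum]
    apply Finset.sum_congr rfl
    intro j _
    simp [smul_eq_C_mul]
    ring

theorem klPhi_mem (r l J N : ℕ) (hl : 0 < l) (hN : N ≤ r) (hr : 0 < r) (T : F[X]) (hT : T.natDegree ≤ N * (r + 1))
    (v : (Fin J → degreeLT F (l + N)) × (Fin J → degreeLT F l)) :
    klPhi r l J N T v ∈ degreeLT F ((l + N) * r + J) := by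
  change (∑ j : Fin J, (expand F r (v.1 j : F[X]) + expand F r (v.2 j : F[X]) * T) * X ^ (j : ℕ)) ∈ _
  apply Submodule.sum_mem
  intro j _
  have hj := j.2
  have hP : ∀ (k : ℕ) (_ : 0 < k) (P : degreeLT F k), (expand F r (P : F[X])).natDegree ≤ (k - 1) * r := by
    intro k hk P
    rw [natDegree_expand]
    apply Nat.mul_le_mul_right
    have := P.2
    rw [mem_degreeLT] at this
    have := kl_ndeg hk this
    omega
  have h1 := hP _ (by omega) (v.1 j)
  have h2 := hP _ hl (v.2 j)
  rw [mem_degreeLT]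
  apply lt_of_le_of_lt degree_le_natDegree
  norm_cast
  have h3 : (expand F r (v.2 j : F[X]) * T).natDegree ≤ (l - 1) * r + N * (r + 1) :=
    natDegree_mul_le.trans (add_le_add h2 hT)
  have h4 := natDegree_add_le (expand F r (v.1 j : F[X])) (expand F r (v.2 j : F[X]) * T)
  have h5 := natDegree_mul_le (p := expand F r (v.1 j : F[X]) + expand F r (v.2 j : F[X]) * T) (q := X ^ (j:ℕ))
  rw [natDegree_X_pow] at h5
  obtain ⟨l, rfl⟩ : ∃ k, l = k + 1 := ⟨l - 1, by omega⟩
  have h6 : (l + 1 + N - 1) * r = l * r + N * r := by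
    rw [show l + 1 + N - 1 = l + N by omega]; ring
  rw [h6] at h1
  have h7 : (l + 1 - 1) * r + N * (r + 1) = l * r + N * r + N := by simp; ring
  rw [h7] at h3
  have h8 : (l + 1 + N) * r + J = l * r + N * r + r + J := by ring
  rw [h8]
  rcases le_max_iff.mp h4 with h | h <;> omega

theorem klG_pow (c s : F) (m : ℕ) :
    (X ^ (Fintype.card F ^ m) - C s : F[X]) ∣ klG c ^ (Fintype.card F ^ m) + C c := by
  rw [← kl_expand m (klG c)]
  have h : expand F (Fintype.card F ^ m) (klG c) + C c =
      ((X ^ (Fintype.card F ^ m)) ^ (Fintype.card F) - X ^ (Fintype.card F ^ m)) ^ 2 := by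
    unfold klG
    simp
  rw [h]
  apply Dvd.dvd.pow _ two_ne_zero
  have h1 := sub_dvd_pow_sub_pow (X ^ (Fintype.card F ^ m) : F[X]) (C s) (Fintype.card F)
  rw [← C_pow, FiniteField.pow_card] at h1
  have h2 := dvd_sub h1 (dvd_refl (X ^ (Fintype.card F ^ m) - C s : F[X]))
  convert h2 using 1
  ring

theorem kl_nonvanish (hq : Odd (Fintype.card F)) (c s : F) (hc : c ≠ 0) (m l J r : ℕ)
    (hr : r = Fintype.card F ^ m) (h1 : 2 * (l + Fintype.card F) ≤ r)
    (P R : Fin J → F[X]) (hP : ∀ j, (P j).natDegree < l + Fintype.card F)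
    (hR : ∀ j, (R j).natDegree < l)
    (h : ∑ j : Fin J, (P j + R j * klG c ^ ((r + 1) / 2)) * (X ^ r - C s) ^ (j : ℕ) = 0) :
    ∀ j, P j = 0 ∧ R j = 0 := by
  have hr0 : 0 < r := by rw [hr]; exact pow_pos Fintype.card_pos _
  set W : F[X] := X ^ r - C s with hW
  have hWm : W.Monic := monic_X_pow_sub_C s hr0.ne'
  have hW0 : W ≠ 0 := hWm.ne_zero
  have hWd : W.natDegree = r := natDegree_X_pow_sub_C
  set T := klG c ^ ((r + 1) / 2) with hT
  have hro : Odd r := by rw [hr]; exact hq.pow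
  have hT2 : T ^ 2 = klG c ^ r * klG c := by
    rw [hT, ← pow_mul, ← pow_succ]
    congr 1
    obtain ⟨k, hk⟩ := hro
    omega
  have key : ∀ n : ℕ, ∀ j : Fin J, (j : ℕ) = n → P j = 0 ∧ R j = 0 := by
    intro n
    induction n using Nat.strong_induction_on with
    | _ n ih =>
    intro j hj
    have hdiv : ∀ (Z : Fin J → F[X]), (∀ i : Fin J, (i : ℕ) < n → Z i = 0) →
        ∃ D, ∑ i, Z i * W ^ (i : ℕ) = W ^ n * (Z j + W * D) := by
      intro Z hZ
      have : W ^ (n + 1) ∣ ∑ i, Z i * W ^ (i : ℕ) - Z j * W ^ n := by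
        rw [← Finset.add_sum_erase _ _ (Finset.mem_univ j), hj, add_sub_cancel_left]
        apply Finset.dvd_sum
        intro i hi
        rcases lt_trichotomy (i : ℕ) n with h | h | h
        · rw [hZ i h]; simp
        · exact absurd (Fin.ext (h.trans hj.symm)) (Finset.ne_of_mem_erase hi)
        · exact Dvd.dvd.mul_left (pow_dvd_pow _ h) _
      obtain ⟨D, hD⟩ := this
      refine ⟨D, ?_⟩
      linear_combination hD
    obtain ⟨D1, hD1⟩ := hdiv P (fun i hi => (ih _ hi i rfl).1)
    obtain ⟨D2, hD2⟩ := hdiv R (fun i hi => (ih _ hi i rfl).2)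
    have hsum : ∑ i, P i * W ^ (i : ℕ) + T * ∑ i, R i * W ^ (i : ℕ) = 0 := by
      rw [Finset.mul_sum, ← Finset.sum_add_distrib, ← h]
      apply Finset.sum_congr rfl
      intro i _
      ring
    rw [hD1, hD2] at hsum
    have h3 : (P j + W * D1) + T * (R j + W * D2) = 0 := by
      have : W ^ n * ((P j + W * D1) + T * (R j + W * D2)) = 0 := by linear_combination hsum
      exact (mul_eq_zero.mp this).resolve_left (pow_ne_zero _ hW0)
    obtain ⟨D3, hD3⟩ := klG_pow c s m
    rw [← hr, ← hW] at hD3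
    have h4 : W ∣ P j ^ 2 + C c * klG c * R j ^ 2 := by
      refine ⟨- (2 * P j * D1 + W * D1 ^ 2) + (klG c ^ r * klG c) * (2 * R j * D2 + W * D2 ^ 2)
        + D3 * klG c * R j ^ 2, ?_⟩
      have h5 : (P j + W * D1) ^ 2 = (klG c ^ r * klG c) * (R j + W * D2) ^ 2 := by
        rw [← hT2]
        have : P j + W * D1 = - (T * (R j + W * D2)) := by linear_combination h3
        rw [this]; ring
      linear_combination h5 + (klG c * R j ^ 2) * hD3
    have h6 : P j ^ 2 + C c * klG c * R j ^ 2 = 0 := by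
      apply eq_zero_of_dvd_of_natDegree_lt h4
      rw [hWd]
      have a1 := hP j
      have a2 := hR j
      have e1 : (P j ^ 2).natDegree ≤ 2 * (P j).natDegree := natDegree_pow_le
      have e2 : (R j ^ 2).natDegree ≤ 2 * (R j).natDegree := natDegree_pow_le
      have e3 : (C c * klG c * R j ^ 2).natDegree ≤ 2 * Fintype.card F + (R j ^ 2).natDegree := by
        apply natDegree_mul_le.trans
        apply Nat.add_le_add_right
        rw [← klG_natDegree c]
        exact natDegree_C_mul_le _ _
      have e4 := natDegree_add_le (P j ^ 2) (C c * klG c * R j ^ 2)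
      rcases le_max_iff.mp e4 with h | h <;> omega
    apply kl_sq_aux (klG c) (klG_squarefree hq c hc) _ (-c) (neg_ne_zero.mpr hc)
    · rw [C_neg]; linear_combination h6
    · rw [klG_natDegree]; have := Fintype.card_pos (α := F); omega
  exact fun j => key j j rfl

theorem kl_stepanov (hq : Odd (Fintype.card F)) (c s : F) (hc : c ≠ 0) (m l J r : ℕ)
    (hr : r = Fintype.card F ^ m) (hl : 0 < l) (h1 : 2 * (l + Fintype.card F) ≤ r)
    (h2 : (l + Fintype.card F) * r + J < J * (2 * l + Fintype.card F)) :
    ∃ g : F[X], g ≠ 0 ∧ g.natDegree ≤ l + Fintype.card F + Fintype.card F * r + r * J ∧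
      ∀ (K : Type _) [Field K] [Algebra F K] (y : K), y ^ (r * r) = y + algebraMap F K s →
        ((aeval y (klG c)) ^ ((r + 1) / 2)) ^ r = (aeval y (klG c)) ^ ((r + 1) / 2) →
        aeval y g = 0 := by
  have hr0 : 0 < r := by rw [hr]; exact pow_pos Fintype.card_pos _
  have hro : Odd r := by rw [hr]; exact hq.pow
  set q := Fintype.card F with hqd
  set T := klG c ^ ((r + 1) / 2) with hT
  have hTd : T.natDegree ≤ q * (r + 1) := by
    rw [hT]
    apply natDegree_pow_le.trans
    rw [klG_natDegree, ← hqd]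
    obtain ⟨k, hk⟩ := hro
    have : (r + 1) / 2 = k + 1 := by omega
    rw [this, hk]
    apply le_of_eq; ring
  have hmem := klPhi_mem (F := F) r l J q hl (by omega) hr0 T hTd
  let Φ := LinearMap.codRestrict _ (klPhi (F := F) r l J q T) hmem
  have hfd : ∀ n, Module.Finite F (degreeLT F n) := fun n => Module.Finite.equiv (degreeLTEquiv F n).symm
  have hfr : ∀ n, Module.finrank F (degreeLT F n) = n := by
    intro n
    rw [(degreeLTEquiv F n).finrank_eq, Module.finrank_fin_fun]
  have hker : LinearMap.ker Φ ≠ ⊥ := by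
    apply LinearMap.ker_ne_bot_of_finrank_lt
    rw [hfr, Module.finrank_prod, Module.finrank_pi_fintype, Module.finrank_pi_fintype]
    simp only [hfr, Finset.sum_const, Finset.card_univ, Fintype.card_fin, smul_eq_mul]
    calc _ < _ := h2
      _ = _ := by ring
  obtain ⟨v, hv, hv0⟩ := Submodule.exists_mem_ne_zero_of_ne_bot hker
  have hv1 : klPhi r l J q T v = 0 := by
    have := LinearMap.mem_ker.mp hv
    exact congrArg Subtype.val this
  have hdeg : ∀ (k : ℕ) (_ : 0 < k) (P : degreeLT F k), (P : F[X]).natDegree < k := by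
    intro k hk P
    have := P.2
    rw [mem_degreeLT] at this
    exact kl_ndeg hk this
  refine ⟨∑ j : Fin J, ((v.1 j : F[X]) + (v.2 j : F[X]) * T) * (X ^ r - C s) ^ (j : ℕ), ?_, ?_, ?_⟩
  · intro h0
    have := kl_nonvanish hq c s hc m l J r hr h1 (fun j => (v.1 j : F[X])) (fun j => (v.2 j : F[X]))
      (fun j => hdeg _ (by omega) _) (fun j => hdeg _ hl _) h0
    apply hv0
    ext j : 2
    · exact Subtype.ext (this j).1
    · exact Subtype.ext (this j).2
  · apply natDegree_sum_le_of_forall_le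
    intro j _
    apply natDegree_mul_le.trans
    have a1 := hdeg _ (by omega) (v.1 j)
    have a2 := hdeg _ hl (v.2 j)
    have a3 : ((v.2 j : F[X]) * T).natDegree ≤ l + q * (r + 1) :=
      natDegree_mul_le.trans (add_le_add a2.le hTd)
    have a4 := natDegree_add_le (v.1 j : F[X]) ((v.2 j : F[X]) * T)
    have a5 : ((X ^ r - C s : F[X]) ^ (j : ℕ)).natDegree ≤ r * J := by
      apply natDegree_pow_le.trans
      rw [natDegree_X_pow_sub_C, mul_comm]
      exact Nat.mul_le_mul_left _ j.2.le
    have a6 : q * (r + 1) = q * r + q := by ring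
    rcases le_max_iff.mp a4 with h | h <;> omega
  · intro K _ _ y hy hw
    have hsr : s ^ r = s := by rw [hr]; exact FiniteField.pow_card_pow m s
    have hex : ∀ P : F[X], aeval (y) (expand F r P) = (aeval y P) ^ r := by
      intro P
      rw [hr, kl_expand, map_pow]
    have h3 : aeval y (klPhi r l J q T v) = 0 := by rw [hv1]; simp
    change aeval y (∑ j : Fin J, (expand F r (v.1 j : F[X]) + expand F r (v.2 j : F[X]) * T) * X ^ (j : ℕ)) = 0 at h3
    have h4 : (aeval y (∑ j : Fin J, ((v.1 j : F[X]) + (v.2 j : F[X]) * T) * (X ^ r - C s) ^ (j : ℕ))) ^ r = 0 := by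
      rw [← hex, ← h3, map_sum, map_sum, map_sum]
      apply Finset.sum_congr rfl
      intro j _
      have e1 : expand F r (X ^ r - C s) = X ^ (r * r) - C s := by
        simp [← pow_mul]
      simp only [map_mul, map_add, map_pow] at *
      rw [show (expand F r) (X ^ r - C s) = X ^ (r * r) - C s from e1]
      have e2 : aeval y (X ^ (r * r) - C s : F[X]) = y := by
        simp [hy]
      have e3 : aeval y ((expand F r) T) = aeval y T := by
        rw [hex, hT, map_pow]; exact hw
      rw [e2, e3, aeval_X]
    exact pow_eq_zero_iff hr0.ne' |>.mp h4

variable {K : Type*} [Field K] [Algebra F K]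

theorem kl_add_pow (i : ℕ) (x y : K) :
    (x + y) ^ (Fintype.card F ^ i) = x ^ (Fintype.card F ^ i) + y ^ (Fintype.card F ^ i) := by
  induction i generalizing x y with
  | zero => simp
  | succ i ih =>
    have h : ∀ x y : K, (x + y) ^ Fintype.card F = x ^ Fintype.card F + y ^ Fintype.card F := by
      intro x y
      have := map_add (FiniteField.frobeniusAlgHom F K) x y
      simpa using this
    rw [pow_succ, pow_mul, pow_mul, pow_mul, ih, h]

theorem kl_alg_pow (i : ℕ) (s : F) : (algebraMap F K s) ^ (Fintype.card F ^ i) = algebraMap F K s := by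
  rw [← map_pow, FiniteField.pow_card_pow]

/-- the trace-like sum -/
def klTau (F : Type*) [Fintype F] {K : Type*} [Field K] (n : ℕ) (z : K) : K :=
  ∑ i ∈ Finset.range n, z ^ (Fintype.card F ^ i)

theorem kl_artin (n : ℕ) (y u : K) (h : y ^ Fintype.card F = y + u) :
    y ^ (Fintype.card F ^ n) = y + klTau F n u := by
  induction n with
  | zero => simp [klTau]
  | succ n ih =>
    rw [pow_succ', pow_mul, h, kl_add_pow, ih]
    unfold klTau
    rw [Finset.sum_range_succ]
    ring

open Classical in
/-- nonzero elements of the degree n extension -/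
noncomputable def klX (F : Type*) [Fintype F] (K : Type*) [Field K] (n : ℕ) : Finset K :=
  ((X ^ (Fintype.card F ^ n) - X : K[X]).roots.toFinset).erase 0

theorem klX_mem (n : ℕ) (hn : n ≠ 0) (x : K) : x ∈ klX F K n ↔ x ≠ 0 ∧ x ^ (Fintype.card F ^ n) = x := by
  unfold klX
  have := FiniteField.X_pow_card_pow_sub_X_ne_zero K hn (Fintype.one_lt_card (α := F))
  simp [this, sub_eq_zero]

open Classical in
theorem kl_card_roots [IsAlgClosed K] (n : ℕ) (hn : n ≠ 0) (u : K) :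
    ((X ^ (Fintype.card F ^ n) - X - C u : K[X]).roots.toFinset).card = Fintype.card F ^ n := by
  have hq : (Fintype.card F : K) = 0 := by
    have : (Fintype.card F : F) = 0 := Nat.cast_card_eq_zero F
    have h2 := congrArg (algebraMap F K) this
    rwa [map_natCast, map_zero] at h2
  have h1 : 1 < Fintype.card F ^ n := Nat.one_lt_pow hn (Fintype.one_lt_card (α := F))
  have hsep : (X ^ (Fintype.card F ^ n) - X - C u : K[X]).Separable := by
    have hd : derivative (X ^ (Fintype.card F ^ n) - X - C u : K[X]) = -1 := by
      rw [derivative_sub, derivative_sub, derivative_X_pow, derivative_X, derivative_C]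
      simp only [Nat.cast_pow, hq, zero_pow hn]
      simp
    rw [Polynomial.Separable, hd]
    exact ⟨0, -1, by ring⟩
  have hdeg : (X ^ (Fintype.card F ^ n) - X - C u : K[X]).natDegree = Fintype.card F ^ n := by
    rw [natDegree_sub_C, FiniteField.X_pow_card_sub_X_natDegree_eq K h1]
  rw [Multiset.toFinset_card_of_nodup (nodup_roots hsep)]
  exact (IsAlgClosed.splits (X ^ (Fintype.card F ^ n) - X - C u : K[X])).natDegree_eq_card_roots.symm.trans hdeg

open Classical in
theorem klX_card [IsAlgClosed K] (n : ℕ) (hn : n ≠ 0) : (klX F K n).card = Fintype.card F ^ n - 1 := by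
  have := kl_card_roots (F := F) (K := K) n hn 0
  unfold klX
  rw [Finset.card_erase_of_mem]
  · simp at this
    rw [← this]
    congr
  · have h0 := FiniteField.X_pow_card_pow_sub_X_ne_zero K hn (Fintype.one_lt_card (α := F))
    simp [h0]

theorem klTau_mem (n : ℕ) (z : K) (hz : z ^ (Fintype.card F ^ n) = z) :
    ∃ s : F, klTau F n z = algebraMap F K s := by
  have h : (klTau F n z) ^ Fintype.card F = klTau F n z := by
    have h1 : (klTau F n z) ^ Fintype.card F = ∑ i ∈ Finset.range n, z ^ (Fintype.card F ^ (i+1)) := by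
      have := map_sum (FiniteField.frobeniusAlgHom F K) (fun i => z ^ (Fintype.card F ^ i)) (Finset.range n)
      simp only [FiniteField.coe_frobeniusAlgHom] at this
      unfold klTau
      rw [this]
      apply Finset.sum_congr rfl
      intro i _
      rw [← pow_mul, pow_succ]
    rw [h1]
    have h2 := Finset.sum_range_succ (fun i => z ^ (Fintype.card F ^ i)) n
    have h3 := Finset.sum_range_succ' (fun i => z ^ (Fintype.card F ^ i)) n
    unfold klTau
    rw [hz] at h2
    rw [h2] at h3
    simp at h3
    exact h3.symm
  have hp : (X ^ Fintype.card F - X : F[X]) = ∏ a : F, (X - C a) := by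
    have h1 := Fintype.one_lt_card (α := F)
    have hr := FiniteField.roots_X_pow_card_sub_X F
    have hmon : (X ^ Fintype.card F - X : F[X]).Monic := by
      apply monic_X_pow_sub
      rw [degree_X]
      exact_mod_cast h1
    have := prod_multiset_X_sub_C_of_monic_of_roots_card_eq hmon
      (by rw [hr, FiniteField.X_pow_card_sub_X_natDegree_eq F h1]; rfl)
    rw [hr] at this
    exact this.symm
  have h2 := congrArg (aeval (klTau F n z)) hp
  simp only [map_sub, map_pow, aeval_X, h, sub_self, map_prod, aeval_C] at h2
  obtain ⟨s, _, hs⟩ := Finset.prod_eq_zero_iff.mp h2.symm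
  exact ⟨s, sub_eq_zero.mp hs⟩

open Classical in
theorem kl_count [IsAlgClosed K] (hq : Odd (Fintype.card F)) (a b s : F) (ha : a ≠ 0) (hb : b ≠ 0) (m : ℕ) (hm : 3 ≤ m) :
    Fintype.card F * ((klX F K (2 * m)).filter (fun x => klTau F (2 * m) (algebraMap F K a * x + algebraMap F K b * x⁻¹)
      = algebraMap F K s)).card ≤ Fintype.card F ^ (2 * m) + (6 * Fintype.card F + 8) * Fintype.card F ^ m := by
  have h40 : (4 : F) * a * b ≠ 0 := by
    have h2 := kl_two_ne (F := F) hq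
    have : (4 : F) = 2 * 2 := by norm_num
    rw [this]
    exact mul_ne_zero (mul_ne_zero (mul_ne_zero h2 h2) ha) hb
  set q := Fintype.card F with hqd
  set r := q ^ m with hr
  have hq3 : 3 ≤ q := by
    have : 1 < q := Fintype.one_lt_card
    obtain ⟨k, hk⟩ := hq
    omega
  have hrb : 9 * q ≤ r := by
    calc 9 * q = 3 * 3 * q := by ring
      _ ≤ q * q * q := by gcongr
      _ = q ^ 3 := by ring
      _ ≤ q ^ m := Nat.pow_le_pow_right (by omega) hm
  have hro : Odd r := hq.pow
  have hQ : q ^ (2 * m) = r * r := by rw [hr, two_mul, pow_add]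
  obtain ⟨g, hg0, hgd, hg⟩ := kl_stepanov hq (4 * a * b) s h40 m (r / 4 + 1) ((r + 1) / 2 + 2 * q) r hr
    (by omega) (by rw [← hqd]; omega) (by
      rw [← hqd]
      obtain ⟨k, hk⟩ := hro
      have e1 : (r + 1) / 2 = k + 1 := by omega
      rw [e1]
      obtain ⟨t, ht⟩ : ∃ t, t = r / 4 + 1 := ⟨_, rfl⟩
      rw [← ht]
      have e2 : r < 4 * t := by omega
      rw [hk] at *
      nlinarith [Nat.zero_le t])
  set Z := (g.map (algebraMap F K)).roots.toFinset with hZ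
  have hZc : Z.card ≤ g.natDegree := by
    rw [hZ]
    apply (Multiset.toFinset_card_le _).trans
    apply (card_roots' _).trans
    exact natDegree_map_le
  have hkey := Finset.card_mul_le_card_mul (s := (klX F K (2 * m)).filter (fun x => klTau F (2 * m) (algebraMap F K a * x + algebraMap F K b * x⁻¹)
      = algebraMap F K s)) (t := Z) (fun x y => y ^ q = y + (algebraMap F K a * x + algebraMap F K b * x⁻¹)) (m := q) (n := 2) ?_ ?_
  · have : (r + 1) / 2 * 2 = r + 1 := by
      obtain ⟨k, hk⟩ := hro
      omega
    have h5 : (r / 4 + 1 + q + q * r + r * ((r + 1) / 2 + 2 * q)) * 2 ≤ r * r + (6 * q + 8) * r := by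
      have e1 : r / 4 + 1 + q ≤ r := by omega
      have e2 : r * ((r + 1) / 2 + 2 * q) * 2 = r * (r + 1) + 4 * q * r := by calc _ = r * ((r + 1) / 2 * 2) + 4 * q * r := by ring
          _ = _ := by rw [this]
      nlinarith
    rw [hQ]
    nlinarith
  · intro x hx
    rw [Finset.mem_filter, klX_mem _ (by omega)] at hx
    obtain ⟨⟨hx0, hxQ⟩, hxs⟩ := hx
    set u := algebraMap F K a * x + algebraMap F K b * x⁻¹ with hu
    have hcard := kl_card_roots (F := F) (K := K) 1 one_ne_zero u
    rw [pow_one] at hcard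
    refine hcard.symm.le.trans ?_
    apply Finset.card_le_card
    intro y hy
    simp at hy
    have hy1 : y ^ q = y + u := by linear_combination hy.2
    rw [Finset.mem_bipartiteAbove]
    refine ⟨?_, hy1⟩
    have hyQ : y ^ (r * r) = y + algebraMap F K s := by
      rw [← hQ, kl_artin (F := F) (2 * m) y u hy1, hxs]
    have hev : aeval y (klG (4 * a * b)) = (algebraMap F K a * x - algebraMap F K b * x⁻¹) ^ 2 := by
      unfold klG
      simp only [map_sub, map_pow, aeval_X, aeval_C, map_mul, map_ofNat]
      rw [← hqd, hy1, hu]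
      field_simp
      ring
    have hwQ : (algebraMap F K a * x - algebraMap F K b * x⁻¹) ^ (r * r) = (algebraMap F K a * x - algebraMap F K b * x⁻¹) := by
      have := kl_add_pow (F := F) (2 * m) (algebraMap F K a * x) (algebraMap F K (-b) * x⁻¹)
      rw [mul_pow, mul_pow, kl_alg_pow, kl_alg_pow, inv_pow, hxQ, map_neg, ← hqd, hQ] at this
      convert this using 2 <;> ring
    have hgy := hg K y hyQ (by
      rw [hev]
      have : (r + 1) / 2 * 2 = r + 1 := by
        obtain ⟨k, hk⟩ := hro
        omega
      rw [← pow_mul _ 2, mul_comm 2, this, ← pow_mul, add_mul, one_mul, pow_add, hwQ, pow_succ, mul_comm])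
    rw [hZ, Multiset.mem_toFinset, mem_roots (Polynomial.map_ne_zero hg0), IsRoot, eval_map_algebraMap]
    exact hgy
  · intro y hy
    have h0 : (C (algebraMap F K a) * X ^ 2 + C (-(y ^ q - y)) * X + C (algebraMap F K b) : K[X]) ≠ 0 := by
      intro h
      have := congrArg (fun p => coeff p 2) h
      simp only [coeff_add, coeff_C_mul, coeff_X_pow, coeff_X, coeff_C, coeff_zero] at this
      simp at this
      exact ha this
    have hd : (C (algebraMap F K a) * X ^ 2 + C (-(y ^ q - y)) * X + C (algebraMap F K b) : K[X]).natDegree ≤ 2 :=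
      natDegree_quadratic_le
    refine le_trans (Finset.card_le_card (t := (C (algebraMap F K a) * X ^ 2 + C (-(y ^ q - y)) * X + C (algebraMap F K b) : K[X]).roots.toFinset) ?_)
      (((Multiset.toFinset_card_le _).trans (card_roots' _)).trans hd)
    intro x hx
    rw [Finset.mem_bipartiteBelow, Finset.mem_filter, klX_mem _ (by omega)] at hx
    obtain ⟨⟨⟨hx0, _⟩, _⟩, hxy⟩ := hx
    rw [Multiset.mem_toFinset, mem_roots h0, IsRoot]
    simp
    rw [hxy]
    field_simp
    ring

open Classical in
/-- descend trace to base field -/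
noncomputable def klTr (F : Type*) [Field F] [Fintype F] {K : Type*} [Field K] [Algebra F K] (n : ℕ) (z : K) : F :=
  if h : ∃ s : F, klTau F n z = algebraMap F K s then h.choose else 0

theorem klTr_spec (n : ℕ) (z : K) (hz : z ^ (Fintype.card F ^ n) = z) :
    algebraMap F K (klTr F n z) = klTau F n z := by
  have h := klTau_mem (F := F) n z hz
  unfold klTr
  rw [dif_pos h]
  exact h.choose_spec.symm

theorem klTr_eq (n : ℕ) (z : K) (s : F) (hz : klTau F n z = algebraMap F K s) : klTr F n z = s := by
  have h : ∃ s : F, klTau F n z = algebraMap F K s := ⟨s, hz⟩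
  unfold klTr
  rw [dif_pos h]
  apply (algebraMap F K).injective
  rw [← hz]
  exact h.choose_spec.symm

theorem kl_fix (n : ℕ) (a b : F) (x : K) (hx : x ^ (Fintype.card F ^ n) = x) :
    (algebraMap F K a * x + algebraMap F K b * x⁻¹) ^ (Fintype.card F ^ n) =
      algebraMap F K a * x + algebraMap F K b * x⁻¹ := by
  rw [kl_add_pow, mul_pow, mul_pow, kl_alg_pow, kl_alg_pow, inv_pow, hx]

/-- Kloosterman sum over the degree n extension -/
noncomputable def klS (F : Type*) [Field F] [Fintype F] (K : Type*) [Field K] [Algebra F K] (ψ : AddChar F ℂ) (a b : F) (n : ℕ) : ℂ :=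
  ∑ x ∈ klX F K n, ψ (klTr F n (algebraMap F K a * x + algebraMap F K b * x⁻¹))

open Classical in
theorem klS_bound [IsAlgClosed K] (hq : Odd (Fintype.card F)) (ψ : AddChar F ℂ) (hψ : ψ ≠ 1) (a b : F) (ha : a ≠ 0) (hb : b ≠ 0)
    (m : ℕ) (hm : 3 ≤ m) : ‖klS F K ψ a b (2 * m)‖ ≤ (6 * Fintype.card F + 9) * (Fintype.card F : ℝ) ^ m := by
  set N : F → ℕ := fun s => ((klX F K (2 * m)).filter (fun x => klTr F (2 * m) (algebraMap F K a * x + algebraMap F K b * x⁻¹)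
      = s)).card with hN
  set q := Fintype.card F with hqd
  have hq0 : (0 : ℝ) < q := by exact_mod_cast Fintype.card_pos (α := F)
  have hN1 : ∀ s, (q : ℝ) * N s ≤ (q : ℝ) ^ (2 * m) + (6 * q + 8) * (q : ℝ) ^ m := by
    intro s
    have := kl_count (K := K) hq a b s ha hb m hm
    have h2 : ((klX F K (2 * m)).filter (fun x => klTau F (2 * m) (algebraMap F K a * x + algebraMap F K b * x⁻¹)
      = algebraMap F K s)) = ((klX F K (2 * m)).filter (fun x => klTr F (2 * m) (algebraMap F K a * x + algebraMap F K b * x⁻¹)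
      = s)) := by
      apply Finset.filter_congr
      intro x hx
      rw [klX_mem _ (by omega)] at hx
      rw [← klTr_spec _ _ (kl_fix (F := F) (2 * m) a b x hx.2)]
      exact (algebraMap F K).injective.eq_iff
    rw [h2] at this
    exact_mod_cast this
  have hNs : ∑ s, (N s : ℝ) = (q : ℝ) ^ (2 * m) - 1 := by
    have h1 := Finset.card_eq_sum_card_fiberwise (s := klX F K (2 * m)) (t := Finset.univ)
      (f := fun x => klTr F (2 * m) (algebraMap F K a * x + algebraMap F K b * x⁻¹)) (by intro x _; simp)
    rw [klX_card _ (by omega)] at h1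
    have h2 : ((Fintype.card F ^ (2 * m) - 1 : ℕ) : ℝ) = ∑ s, (N s : ℝ) := by
      rw [h1]; push_cast; rfl
    rw [← h2, Nat.cast_sub (Nat.one_le_pow _ _ Fintype.card_pos)]
    simp [hqd]
  have hS : klS F K ψ a b (2 * m) = ∑ s, (N s : ℂ) * ψ s := by
    unfold klS
    rw [← Finset.sum_fiberwise_of_maps_to (s := klX F K (2 * m)) (t := Finset.univ)
      (g := fun x => klTr F (2 * m) (algebraMap F K a * x + algebraMap F K b * x⁻¹)) (by intro x _; simp)]
    apply Finset.sum_congr rfl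
    intro s _
    rw [Finset.sum_congr rfl (g := fun _ => ψ s)]
    · rw [Finset.sum_const, nsmul_eq_mul]
    · intro x hx
      rw [(Finset.mem_filter.mp hx).2]
  set D : ℝ := ((q : ℝ) ^ (2 * m) + (6 * q + 8) * (q : ℝ) ^ m) / q with hD
  have hND : ∀ s, (N s : ℝ) ≤ D := by
    intro s
    rw [hD, le_div_iff₀ hq0, mul_comm]
    exact hN1 s
  have hS2 : klS F K ψ a b (2 * m) = ∑ s, (((N s : ℝ) - D : ℝ) : ℂ) * ψ s := by
    rw [hS]
    have h0 : ∑ s, ψ s = 0 := AddChar.sum_eq_zero_of_ne_one hψ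
    have : ∑ s, (((N s : ℝ) - D : ℝ) : ℂ) * ψ s = ∑ s, (N s : ℂ) * ψ s - D * ∑ s, ψ s := by
      rw [Finset.mul_sum, ← Finset.sum_sub_distrib]
      apply Finset.sum_congr rfl
      intro s _
      push_cast
      ring
    rw [this, h0]
    simp
  rw [hS2]
  have h3 : ‖∑ s, (((N s : ℝ) - D : ℝ) : ℂ) * ψ s‖ ≤ ∑ s, (D - N s) := by
    apply (norm_sum_le _ _).trans
    apply Finset.sum_le_sum
    intro s _
    rw [norm_mul, AddChar.norm_apply, mul_one, Complex.norm_real, Real.norm_eq_abs, abs_sub_comm, abs_of_nonneg]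
    linarith [hND s]
  apply h3.trans
  rw [Finset.sum_sub_distrib, hNs, Finset.sum_const, Finset.card_univ, ← hqd, nsmul_eq_mul, hD, mul_div_cancel₀ _ hq0.ne']
  have : (1 : ℝ) ≤ (q : ℝ) ^ m := by
    exact_mod_cast Nat.one_le_pow _ _ Fintype.card_pos
  nlinarith

theorem kl_expand_aeval (i : ℕ) (P : F[X]) (x : K) : (aeval x P) ^ (Fintype.card F ^ i) = aeval (x ^ (Fintype.card F ^ i)) P := by
  rw [← map_pow, ← kl_expand, expand_aeval]

open Classical in
/-- the multiplicative function on monic polynomials -/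
noncomputable def klLam (ψ : AddChar F ℂ) (a b : F) (f : F[X]) : ℂ :=
  if f.coeff 0 = 0 then 0 else ψ (-a * f.nextCoeff - b * (f.coeff 1 / f.coeff 0))

theorem klLam_mul (ψ : AddChar F ℂ) (a b : F) (f g : F[X]) (hf : f.Monic) (hg : g.Monic) :
    klLam ψ a b (f * g) = klLam ψ a b f * klLam ψ a b g := by
  unfold klLam
  rw [mul_coeff_zero, mul_coeff_one, hf.nextCoeff_mul hg]
  by_cases h1 : f.coeff 0 = 0
  · simp [h1]
  by_cases h2 : g.coeff 0 = 0
  · simp [h2]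
  rw [if_neg (mul_ne_zero h1 h2), if_neg h1, if_neg h2, ← AddChar.map_add_eq_mul]
  congr 1
  field_simp
  ring

theorem kl_coeff_one (t : Multiset K) (ht : (0 : K) ∉ t) :
    (t.map (fun z => X - C z)).prod.coeff 0 ≠ 0 ∧
    (t.map (fun z => X - C z)).prod.coeff 1 = - (t.map (fun z => z⁻¹)).sum * (t.map (fun z => X - C z)).prod.coeff 0 := by
  induction t using Multiset.induction_on with
  | empty => simp [coeff_one]
  | cons z t ih =>
    have hz : z ≠ 0 := by rintro rfl; exact ht (Multiset.mem_cons_self _ _)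
    obtain ⟨h1, h2⟩ := ih (fun h => ht (Multiset.mem_cons_of_mem h))
    rw [Multiset.map_cons, Multiset.prod_cons, mul_coeff_zero, mul_coeff_one, Multiset.map_cons, Multiset.sum_cons, h2]
    constructor
    · simp [hz, h1]
    · simp
      field_simp
      ring

theorem kl_pow_iff (x : K) (hx : IsIntegral F x) (k : ℕ) :
    x ^ (Fintype.card F ^ k) = x ↔ (minpoly F x).natDegree ∣ k := by
  rw [(minpoly.irreducible hx).natDegree_dvd_iff_dvd_X_pow_card_pow_sub_X, Nat.card_eq_fintype_card,
    minpoly.dvd_iff]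
  simp [sub_eq_zero]

theorem kl_pow_inj (i : ℕ) : Function.Injective (fun x : K => x ^ (Fintype.card F ^ i)) := by
  intro x y h
  have h1 : (x - y) ^ (Fintype.card F ^ i) = 0 := by
    have := kl_add_pow (F := F) i (x - y) y
    rw [sub_add_cancel] at this
    simp only at h
    rw [h] at this
    linear_combination -this
  have := pow_eq_zero_iff (pow_ne_zero _ Fintype.card_ne_zero) |>.mp h1
  exact sub_eq_zero.mp this

theorem kl_minpoly_map (x : K) (hx : IsIntegral F x) :
    (minpoly F x).map (algebraMap F K) = ∏ i ∈ Finset.range (minpoly F x).natDegree, (X - C (x ^ (Fintype.card F ^ i))) := by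
  set d := (minpoly F x).natDegree with hd
  have hinj : Set.InjOn (fun i => x ^ (Fintype.card F ^ i)) (Finset.range d : Set ℕ) := by
    have key : ∀ i j : ℕ, i < j → j < d → x ^ (Fintype.card F ^ i) ≠ x ^ (Fintype.card F ^ j) := by
      intro i j hij hj h
      obtain ⟨e, rfl⟩ : ∃ e, j = e + i := ⟨j - i, by omega⟩
      rw [pow_add, pow_mul] at h
      have h2 := kl_pow_inj (F := F) (K := K) i h
      have h3 := (kl_pow_iff (F := F) x hx e).mp h2.symm
      have := Nat.le_of_dvd (by omega) h3
      omega
    intro i hi j hj h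
    simp only [Finset.coe_range, Set.mem_Iio] at hi hj
    rcases lt_trichotomy i j with h' | h' | h'
    · exact absurd h (key i j h' hj)
    · exact h'
    · exact absurd h.symm (key j i h' hi)
  have hm : (minpoly F x).Monic := minpoly.monic hx
  have hP : (∏ i ∈ Finset.range d, (X - C (x ^ (Fintype.card F ^ i)))).Monic :=
    monic_prod_of_monic _ _ (fun i _ => monic_X_sub_C _)
  refine (eq_of_monic_of_dvd_of_natDegree_le hP (hm.map _) ?_ ?_)
  · have := Finset.prod_dvd_of_coprime (t := Finset.range d) (s := fun i => X - C (x ^ (Fintype.card F ^ i))) (z := (minpoly F x).map (algebraMap F K)) ?_ ?_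
    · exact this
    · intro i hi j hj hij
      exact pairwise_coprime_X_sub_C (s := id) (fun _ _ h => h) (fun h => hij (hinj hi hj h))
    · intro i _
      rw [dvd_iff_isRoot, IsRoot, eval_map_algebraMap, ← kl_expand_aeval, minpoly.aeval, zero_pow]
      exact pow_ne_zero _ Fintype.card_ne_zero
  · rw [natDegree_map, natDegree_prod_of_monic _ _ (fun i _ => monic_X_sub_C _)]
    simp only [natDegree_X_sub_C, Finset.sum_const, Finset.card_range, smul_eq_mul, mul_one]
    exact le_of_eq hd.symm

theorem kl_chi_map (x : K) (hx : IsIntegral F x) (j : ℕ) :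
    ((minpoly F x) ^ j).map (algebraMap F K) = ∏ i ∈ Finset.range ((minpoly F x).natDegree * j), (X - C (x ^ (Fintype.card F ^ i))) := by
  induction j with
  | zero => simp
  | succ j ih =>
    rw [pow_succ, Polynomial.map_mul, ih, mul_add, mul_one, Finset.prod_range_add, kl_minpoly_map x hx]
    congr 1
    apply Finset.prod_congr rfl
    intro i _
    rw [pow_add, pow_mul, (kl_pow_iff (F := F) x hx _).mpr (dvd_mul_right _ _)]

theorem klLam_chi (ψ : AddChar F ℂ) (a b : F) (x : K) (hx0 : x ≠ 0) (hx : IsIntegral F x) (j : ℕ) :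
    klLam ψ a b ((minpoly F x) ^ j) =
      ψ (klTr F ((minpoly F x).natDegree * j) (algebraMap F K a * x + algebraMap F K b * x⁻¹)) := by
  set n := (minpoly F x).natDegree * j with hn
  have hmap := kl_chi_map x hx j
  rw [← hn] at hmap
  set f := (minpoly F x) ^ j with hf
  set t : Multiset K := (Finset.range n).val.map (fun i => x ^ (Fintype.card F ^ i)) with ht
  have ht0 : (0 : K) ∉ t := by
    rw [ht]
    simp [hx0]
  have hprod : f.map (algebraMap F K) = (t.map (fun z => X - C z)).prod := by
    rw [hmap, ht, Multiset.map_map]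
    rfl
  obtain ⟨h1, h2⟩ := kl_coeff_one t ht0
  have h3 := multiset_prod_X_sub_C_nextCoeff t
  rw [← hprod] at h1 h2 h3
  rw [coeff_map] at h1
  rw [coeff_map, coeff_map] at h2
  rw [nextCoeff_map (algebraMap F K).injective] at h3
  have hf0 : f.coeff 0 ≠ 0 := by
    intro h; rw [h] at h1; simp at h1
  unfold klLam
  rw [if_neg hf0]
  congr 1
  symm
  apply klTr_eq
  rw [map_sub, map_mul, map_mul, map_div₀, h3, h2, mul_div_assoc, div_self h1]
  have e1 : t.sum = ∑ i ∈ Finset.range n, x ^ (Fintype.card F ^ i) := by rw [ht]; rfl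
  have e2 : (t.map (fun z => z⁻¹)).sum = ∑ i ∈ Finset.range n, (x⁻¹) ^ (Fintype.card F ^ i) := by
    rw [ht, Multiset.map_map]
    simp only [inv_pow]
    rfl
  rw [e1, e2]
  unfold klTau
  rw [Finset.sum_congr rfl (g := fun i => algebraMap F K a * x ^ (Fintype.card F ^ i) + algebraMap F K b * (x⁻¹) ^ (Fintype.card F ^ i))]
  · rw [Finset.sum_add_distrib, ← Finset.mul_sum, ← Finset.mul_sum, map_neg]
    ring
  · intro i _
    rw [kl_add_pow, mul_pow, mul_pow, kl_alg_pow, kl_alg_pow]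

theorem kl_pow_dvd_iff (x : K) (hx : IsIntegral F x) (f : F[X]) (hf : f ≠ 0) (j : ℕ) :
    (minpoly F x) ^ j ∣ f ↔ j ≤ (f.map (algebraMap F K)).rootMultiplicity x := by
  have hroot : (X - C x) ∣ (minpoly F x).map (algebraMap F K) := by
    rw [dvd_iff_isRoot, IsRoot, eval_map_algebraMap, minpoly.aeval]
  have hne : ∀ g : F[X], g ≠ 0 → g.map (algebraMap F K) ≠ 0 := fun g hg => by
    rwa [Ne, Polynomial.map_eq_zero]
  have hsep : ((minpoly F x).map (algebraMap F K)).Separable := by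
    rw [separable_map]
    exact PerfectField.separable_of_irreducible (minpoly.irreducible hx)
  obtain ⟨R, hR⟩ := hroot
  have hRx : IsCoprime (X - C x) R := by
    rw [hR] at hsep
    exact hsep.isCoprime
  constructor
  · intro h
    rw [le_rootMultiplicity_iff (hne f hf)]
    have h2 : ((minpoly F x) ^ j).map (algebraMap F K) ∣ f.map (algebraMap F K) := Polynomial.map_dvd _ h
    rw [Polynomial.map_pow, hR, mul_pow] at h2
    exact dvd_trans (dvd_mul_right _ _) h2
  · induction j generalizing f with
    | zero => simp
    | succ j ih =>
      intro h
      have h1 : (X - C x) ^ (j + 1) ∣ f.map (algebraMap F K) := (le_rootMultiplicity_iff (hne f hf)).mp h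
      have h2 : minpoly F x ∣ f := by
        rw [minpoly.dvd_iff, ← eval_map_algebraMap]
        have : (X - C x) ∣ f.map (algebraMap F K) := dvd_trans (dvd_pow_self _ (Nat.succ_ne_zero j)) h1
        exact dvd_iff_isRoot.mp this
      obtain ⟨g, rfl⟩ := h2
      have hg : g ≠ 0 := right_ne_zero_of_mul hf
      rw [pow_succ']
      apply mul_dvd_mul_left
      apply ih g hg
      rw [le_rootMultiplicity_iff (hne g hg)]
      rw [Polynomial.map_mul, hR, pow_succ', mul_assoc] at h1
      have h3 := (mul_dvd_mul_iff_left (X_sub_C_ne_zero x)).mp h1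
      exact (hRx.pow_left).dvd_of_dvd_mul_left h3

open Classical in
theorem kl_degree_sum [IsAlgClosed K] [Algebra.IsAlgebraic F K] (f : F[X]) (hf : f.Monic) (hf0 : f.coeff 0 ≠ 0) (n : ℕ)
    (hn : f.natDegree = n) :
    ∑ k ∈ Finset.Icc 1 n, ((klX F K k).filter (fun x => (minpoly F x) ^ (k / (minpoly F x).natDegree) ∣ f)).card = n := by
  have hInt : ∀ x : K, IsIntegral F x := fun x => Algebra.IsIntegral.isIntegral x
  set fK := f.map (algebraMap F K) with hfK
  have hfK0 : fK ≠ 0 := (hf.map _).ne_zero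
  have hcard : fK.roots.card = n := by
    rw [← hn, ← natDegree_map (algebraMap F K)]
    exact (IsAlgClosed.splits fK).natDegree_eq_card_roots.symm
  rw [← Multiset.toFinset_sum_count_eq] at hcard
  have key : ∀ x ∈ fK.roots.toFinset, fK.roots.count x =
      ∑ k ∈ Finset.Icc 1 n, if (x ∈ klX F K k ∧ (minpoly F x) ^ (k / (minpoly F x).natDegree) ∣ f) then 1 else 0 := by
    intro x hx
    rw [Multiset.mem_toFinset, mem_roots hfK0, IsRoot, hfK, eval_map_algebraMap] at hx
    have hx0 : x ≠ 0 := by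
      rintro rfl
      apply hf0
      rw [← coeff_zero_eq_aeval_zero'] at hx
      simpa using hx
    have hd : 0 < (minpoly F x).natDegree := minpoly.natDegree_pos (hInt x)
    rw [← Finset.card_filter, count_roots]
    set d := (minpoly F x).natDegree with hdd
    set e := fK.rootMultiplicity x with he
    have hde : d * e ≤ n := by
      have h1 := (kl_pow_dvd_iff x (hInt x) f hf.ne_zero e).mpr le_rfl
      have h2 := natDegree_le_of_dvd h1 hf.ne_zero
      rw [natDegree_pow, hn] at h2
      rw [mul_comm]; exact h2
    have : (Finset.Icc 1 n).filter (fun k => x ∈ klX F K k ∧ (minpoly F x) ^ (k / d) ∣ f) = (Finset.Icc 1 e).image (fun j => d * j) := by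
      ext k
      rw [Finset.mem_filter, Finset.mem_Icc, Finset.mem_image]
      constructor
      · rintro ⟨⟨h1, h2⟩, h3, h4⟩
        rw [klX_mem k (by omega), kl_pow_iff x (hInt x)] at h3
        obtain ⟨j, rfl⟩ := h3.2
        rw [← hdd, Nat.mul_div_cancel_left _ hd, kl_pow_dvd_iff x (hInt x) f hf.ne_zero] at h4
        refine ⟨j, Finset.mem_Icc.mpr ⟨?_, h4⟩, rfl⟩
        rcases Nat.eq_zero_or_pos j with h | h
        · rw [h] at h1; omega
        · exact h
      · rintro ⟨j, hj, rfl⟩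
        rw [Finset.mem_Icc] at hj
        have h1 : 1 ≤ d * j := Nat.mul_pos hd hj.1
        refine ⟨⟨h1, le_trans (Nat.mul_le_mul_left _ hj.2) hde⟩, ?_, ?_⟩
        · rw [klX_mem _ (by omega), kl_pow_iff x (hInt x)]
          exact ⟨hx0, dvd_mul_right _ _⟩
        · rw [Nat.mul_div_cancel_left _ hd, kl_pow_dvd_iff x (hInt x) f hf.ne_zero]
          exact hj.2
    rw [this, Finset.card_image_of_injective _ (fun i j h => Nat.eq_of_mul_eq_mul_left hd h)]
    simp
  rw [Finset.sum_congr rfl key, Finset.sum_comm] at hcard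
  refine Eq.trans ?_ hcard
  apply Finset.sum_congr rfl
  intro k hk
  rw [Finset.mem_Icc] at hk
  rw [← Finset.card_filter]
  congr 1
  ext x
  rw [Finset.mem_filter, Finset.mem_filter, Multiset.mem_toFinset, mem_roots hfK0]
  constructor
  · intro h
    refine ⟨?_, h⟩
    rw [IsRoot, hfK, eval_map_algebraMap, ← minpoly.dvd_iff]
    refine dvd_trans (dvd_pow_self _ ?_) h.2
    have h1 := h.1
    rw [klX_mem k (by omega), kl_pow_iff x (hInt x)] at h1
    have := Nat.div_pos (Nat.le_of_dvd (by omega) h1.2) (minpoly.natDegree_pos (hInt x))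
    omega
  · exact fun h => h.2


open Classical in
/-- monic polynomials of degree n -/
noncomputable def klM (F : Type*) [Field F] [Fintype F] (n : ℕ) : Finset F[X] :=
  (Finset.univ : Finset (Fin n → F)).image (fun v => X ^ n + ∑ i : Fin n, C (v i) * X ^ (i : ℕ))

theorem klM_mem (n : ℕ) (f : F[X]) : f ∈ klM F n ↔ f.Monic ∧ f.natDegree = n := by
  classical
  unfold klM
  rw [Finset.mem_image]
  constructor
  · rintro ⟨v, -, rfl⟩
    have hdeg : (∑ i : Fin n, C (v i) * X ^ (i : ℕ)).degree < (n : WithBot ℕ) := by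
      refine (degree_sum_fin_lt (n := n) v)
    refine ⟨monic_X_pow_add hdeg, ?_⟩
    apply natDegree_eq_of_degree_eq_some
    rw [degree_add_eq_left_of_degree_lt, degree_X_pow]
    rw [degree_X_pow]; exact hdeg
  · rintro ⟨h1, rfl⟩
    refine ⟨fun i => f.coeff i, Finset.mem_univ _, ?_⟩
    conv_rhs => rw [h1.as_sum]
    rw [Finset.sum_range]

/-- coefficient of the L-function -/
noncomputable def klA (ψ : AddChar F ℂ) (a b : F) (n : ℕ) : ℂ := ∑ f ∈ klM F n, klLam ψ a b f

open Classical in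
theorem kl_conv [IsAlgClosed K] [Algebra.IsAlgebraic F K] (ψ : AddChar F ℂ) (a b : F) (n : ℕ) :
    (n : ℂ) * klA ψ a b n = ∑ k ∈ Finset.Icc 1 n, klS F K ψ a b k * klA ψ a b (n - k) := by
  have hInt : ∀ x : K, IsIntegral F x := fun x => Algebra.IsIntegral.isIntegral x
  have h1 : (n : ℂ) * klA ψ a b n = ∑ f ∈ klM F n, ∑ k ∈ Finset.Icc 1 n, ∑ x ∈ klX F K k,
      if (minpoly F x) ^ (k / (minpoly F x).natDegree) ∣ f then klLam ψ a b f else 0 := by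
    unfold klA
    rw [Finset.mul_sum]
    apply Finset.sum_congr rfl
    intro f hf
    rw [klM_mem] at hf
    by_cases h0 : f.coeff 0 = 0
    · have : klLam ψ a b f = 0 := by unfold klLam; rw [if_pos h0]
      simp [this]
    · have h2 := kl_degree_sum (K := K) f hf.1 h0 n hf.2
      have h3 : (n : ℂ) = ∑ k ∈ Finset.Icc 1 n, (((klX F K k).filter (fun x => (minpoly F x) ^ (k / (minpoly F x).natDegree) ∣ f)).card : ℂ) := by
        rw [← Nat.cast_sum, h2]
      rw [h3, Finset.sum_mul]
      apply Finset.sum_congr rfl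
      intro k _
      rw [← Finset.sum_filter, Finset.sum_const, nsmul_eq_mul]
  rw [h1, Finset.sum_comm]
  apply Finset.sum_congr rfl
  intro k hk
  rw [Finset.mem_Icc] at hk
  rw [Finset.sum_comm]
  unfold klS
  rw [Finset.sum_mul]
  apply Finset.sum_congr rfl
  intro x hx
  rw [klX_mem k (by omega), kl_pow_iff x (hInt x)] at hx
  obtain ⟨hx0, j, hj⟩ := hx
  have hd : 0 < (minpoly F x).natDegree := minpoly.natDegree_pos (hInt x)
  have hj2 : k / (minpoly F x).natDegree = j := by rw [hj, Nat.mul_div_cancel_left _ hd]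
  rw [hj2]
  have hmon : (minpoly F x ^ j).Monic := (minpoly.monic (hInt x)).pow j
  have hchi := klLam_chi ψ a b x hx0 (hInt x) j
  rw [← hj] at hchi
  rw [← hchi]
  unfold klA
  rw [Finset.mul_sum, ← Finset.sum_filter]
  have hdeg : (minpoly F x ^ j).natDegree = k := by rw [natDegree_pow, hj, mul_comm]
  symm
  apply Finset.sum_bij (fun g _ => minpoly F x ^ j * g)
  · intro g hg
    rw [klM_mem] at hg
    rw [Finset.mem_filter, klM_mem]
    refine ⟨⟨hmon.mul hg.1, ?_⟩, dvd_mul_right _ _⟩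
    rw [hmon.natDegree_mul hg.1, hdeg, hg.2]
    omega
  · intro g _ g' _ h
    exact mul_left_cancel₀ hmon.ne_zero h
  · intro f hf
    rw [Finset.mem_filter, klM_mem] at hf
    obtain ⟨⟨h2, h3⟩, g, rfl⟩ := hf
    have hg : g.Monic := hmon.of_mul_monic_left h2
    refine ⟨g, ?_, rfl⟩
    rw [klM_mem]
    refine ⟨hg, ?_⟩
    rw [hmon.natDegree_mul hg, hdeg] at h3
    omega
  · intro g hg
    rw [klM_mem] at hg
    rw [klLam_mul _ _ _ _ _ hmon hg.1]

theorem klA_zero (ψ : AddChar F ℂ) (a b : F) : klA ψ a b 0 = 1 := by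
  have : klM F 0 = {1} := by
    ext f
    rw [klM_mem, Finset.mem_singleton]
    constructor
    · rintro ⟨h1, h2⟩
      exact h1.natDegree_eq_zero.mp h2
    · rintro rfl
      exact ⟨monic_one, natDegree_one⟩
  unfold klA
  rw [this, Finset.sum_singleton]
  unfold klLam
  simp [nextCoeff, coeff_one]

theorem kl_exists_ne (ψ : AddChar F ℂ) (hψ : ψ ≠ 1) (a : F) (ha : a ≠ 0) : ∃ t : F, ψ (a * t) ≠ 1 := by
  obtain ⟨s, hs⟩ := AddChar.ne_one_iff.mp hψ
  exact ⟨a⁻¹ * s, by rwa [mul_inv_cancel_left₀ ha]⟩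

theorem klA_big (ψ : AddChar F ℂ) (hψ : ψ ≠ 1) (a b : F) (ha : a ≠ 0) (n : ℕ) (hn : 3 ≤ n) : klA ψ a b n = 0 := by
  obtain ⟨t, ht⟩ := kl_exists_ne ψ hψ (-a) (neg_ne_zero.mpr ha)
  have hmem : ∀ (t : F) (f : F[X]), f ∈ klM F n → f + C t * X ^ (n - 1) ∈ klM F n := by
    intro t f hf
    rw [klM_mem] at hf ⊢
    have hlt : (C t * X ^ (n - 1)).degree < f.degree := by
      rw [degree_eq_natDegree hf.1.ne_zero, hf.2]
      refine lt_of_le_of_lt (degree_C_mul_X_pow_le _ _) ?_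
      exact_mod_cast (by omega : n - 1 < n)
    refine ⟨hf.1.add_of_left hlt, ?_⟩
    rw [natDegree_add_eq_left_of_degree_lt hlt, hf.2]
  have key : klA ψ a b n = ψ (-a * t) * klA ψ a b n := by
    unfold klA
    rw [Finset.mul_sum]
    symm
    apply Finset.sum_bij (fun f _ => f + C t * X ^ (n - 1))
    · intro f hf
      exact hmem t f hf
    · intro f _ g _ h
      exact add_right_cancel h
    · intro f hf
      refine ⟨f + C (-t) * X ^ (n - 1), hmem _ _ hf, ?_⟩
      rw [C_neg]; ring
    · intro f hf
      have hf2 := hmem t f hf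
      rw [klM_mem] at hf hf2
      unfold klLam
      have c0 : (f + C t * X ^ (n - 1)).coeff 0 = f.coeff 0 := by
        rw [coeff_add, coeff_C_mul_X_pow, if_neg (by omega), add_zero]
      have c1 : (f + C t * X ^ (n - 1)).coeff 1 = f.coeff 1 := by
        rw [coeff_add, coeff_C_mul_X_pow, if_neg (by omega), add_zero]
      have c2 : (f + C t * X ^ (n - 1)).nextCoeff = f.nextCoeff + t := by
        rw [nextCoeff_of_natDegree_pos (by omega), nextCoeff_of_natDegree_pos (by omega), hf.2, hf2.2]
        simp
      rw [c0, c1, c2]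
      by_cases h0 : f.coeff 0 = 0
      · simp [h0]
      · rw [if_neg h0, if_neg h0, ← AddChar.map_add_eq_mul]
        congr 1
        ring
  have : (1 - ψ (-a * t)) * klA ψ a b n = 0 := by linear_combination key
  rcases mul_eq_zero.mp this with h | h
  · exact absurd (sub_eq_zero.mp h).symm ht
  · exact h

open Classical in
theorem klA_one (ψ : AddChar F ℂ) (a b : F) :
    klA ψ a b 1 = ∑ s ∈ Finset.univ.erase (0 : F), ψ (a * s + b * s⁻¹) := by
  have h : klA ψ a b 1 = ∑ s : F, klLam ψ a b (X - C s) := by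
    unfold klA
    symm
    apply Finset.sum_bij (fun s _ => X - C s)
    · intro s _
      rw [klM_mem]
      exact ⟨monic_X_sub_C s, natDegree_X_sub_C s⟩
    · intro s _ t _ h
      exact C_injective (sub_right_injective h)
    · intro f hf
      rw [klM_mem] at hf
      refine ⟨-f.coeff 0, Finset.mem_univ _, ?_⟩
      conv_rhs => rw [hf.1.as_sum, hf.2]
      simp
    · intro _ _; rfl
  rw [h, ← Finset.sum_erase_add _ _ (Finset.mem_univ (0 : F))]
  have h0 : klLam ψ a b (X - C (0 : F)) = 0 := by unfold klLam; simp
  rw [h0, add_zero]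
  apply Finset.sum_congr rfl
  intro s hs
  have hs0 : s ≠ 0 := Finset.ne_of_mem_erase hs
  unfold klLam
  rw [nextCoeff_X_sub_C]
  simp [hs0, coeff_C, coeff_X]

open Classical in
theorem klA_two (ψ : AddChar F ℂ) (hψ : ψ ≠ 1) (a b : F) (ha : a ≠ 0) (hb : b ≠ 0) :
    klA ψ a b 2 = Fintype.card F := by
  have h : klA ψ a b 2 = ∑ p : F × F, klLam ψ a b (X ^ 2 + (C p.1 * X + C p.2)) := by
    unfold klA
    symm
    apply Finset.sum_bij (fun p _ => X ^ 2 + (C p.1 * X + C p.2))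
    · intro p _
      rw [klM_mem]
      have hdeg : (C p.1 * X + C p.2).degree < ((2 : ℕ) : WithBot ℕ) :=
        lt_of_le_of_lt degree_linear_le (by exact_mod_cast one_lt_two)
      refine ⟨monic_X_pow_add hdeg, ?_⟩
      apply natDegree_eq_of_degree_eq_some
      rw [degree_add_eq_left_of_degree_lt, degree_X_pow]
      rw [degree_X_pow]; exact hdeg
    · intro s _ t _ h
      have h0 := congrArg (fun f => f.coeff 0) h
      have h1 := congrArg (fun f => f.coeff 1) h
      simp [coeff_X_pow, coeff_C] at h0 h1
      exact Prod.ext h1 h0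
    · intro f hf
      rw [klM_mem] at hf
      refine ⟨(f.coeff 1, f.coeff 0), Finset.mem_univ _, ?_⟩
      conv_rhs => rw [hf.1.as_sum, hf.2]
      simp [Finset.sum_range_succ]
      ring
    · intro _ _; rfl
  have hlam : ∀ u v : F, v ≠ 0 → klLam ψ a b (X ^ 2 + (C u * X + C v)) = ψ (u * (-a - b / v)) := by
    intro u v hv
    have hdeg : (C u * X + C v).degree < ((2 : ℕ) : WithBot ℕ) :=
        lt_of_le_of_lt degree_linear_le (by exact_mod_cast one_lt_two)
    have hnd : (X ^ 2 + (C u * X + C v)).natDegree = 2 := by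
      apply natDegree_eq_of_degree_eq_some
      rw [degree_add_eq_left_of_degree_lt, degree_X_pow]
      rw [degree_X_pow]; exact hdeg
    unfold klLam
    rw [nextCoeff_of_natDegree_pos (by omega), hnd]
    simp [coeff_X_pow, coeff_C, hv]
    congr 1
    field_simp
  have hlam0 : ∀ u : F, klLam ψ a b (X ^ 2 + (C u * X + C 0)) = 0 := by
    intro u; unfold klLam; simp
  have hprim : ψ.IsPrimitive := AddChar.IsPrimitive.of_ne_one hψ
  rw [h, Fintype.sum_prod_type_right, ← Finset.sum_erase_add _ _ (Finset.mem_univ (0 : F))]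
  rw [Finset.sum_congr rfl (g := fun v => if v = - b / a then (Fintype.card F : ℂ) else 0)]
  · rw [Finset.sum_ite_eq', if_pos, Finset.sum_eq_zero, add_zero]
    · intro u _; exact hlam0 u
    · simp [ha, hb]
  · intro v hv
    have hv0 : v ≠ 0 := Finset.ne_of_mem_erase hv
    rw [Finset.sum_congr rfl (fun u _ => hlam u v hv0), AddChar.sum_mulShift _ hprim]
    have : (-a - b / v = 0) ↔ v = - b / a := by
      field_simp
      constructor
      · intro h; linear_combination -h
      · intro h; linear_combination -h
    simp only [this]
    push_cast
    rfl


theorem kl_abs (α β : ℂ) (q C : ℝ) (hq : 0 < q) (hαβ : α * β = q)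
    (h : ∀ m : ℕ, 3 ≤ m → ‖α ^ (2 * m) + β ^ (2 * m)‖ ≤ C * q ^ m) : ‖α‖ ≤ √q := by
  by_contra hcon
  push Not at hcon
  have h1 : q < ‖α‖ ^ 2 := by
    have := Real.sq_sqrt hq.le
    nlinarith [Real.sqrt_nonneg q]
  have h2 : ‖α‖ ^ 2 * ‖β‖ ^ 2 = q ^ 2 := by
    rw [← mul_pow, ← norm_mul, hαβ, Complex.norm_real, Real.norm_eq_abs, sq_abs]
  have h3 : ‖β‖ ^ 2 ≤ q := by
    by_contra h4
    push Not at h4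
    nlinarith
  have hr : 1 < ‖α‖ ^ 2 / q := by rwa [lt_div_iff₀ hq, one_mul]
  obtain ⟨n, hn⟩ := pow_unbounded_of_one_lt (C + 1) hr
  have hm := h (max n 3) (le_max_right _ _)
  set m := max n 3 with hmdef
  have h5 : (‖α‖ ^ 2 / q) ^ n ≤ (‖α‖ ^ 2 / q) ^ m := pow_le_pow_right₀ hr.le (le_max_left _ _)
  have h6 : (C + 1) * q ^ m < (‖α‖ ^ 2) ^ m := by
    have := lt_of_lt_of_le hn h5
    rw [div_pow, lt_div_iff₀ (by positivity)] at this
    exact this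
  have h7 : (‖β‖ ^ 2) ^ m ≤ q ^ m := pow_le_pow_left₀ (by positivity) h3 m
  have h8 : ‖α ^ (2 * m)‖ ≤ ‖α ^ (2 * m) + β ^ (2 * m)‖ + ‖β ^ (2 * m)‖ := by
    have := norm_sub_le (α ^ (2 * m) + β ^ (2 * m)) (β ^ (2 * m))
    rwa [add_sub_cancel_right] at this
  rw [norm_pow α, norm_pow β, pow_mul ‖α‖, pow_mul ‖β‖] at h8
  linarith

theorem kl_rec (s : ℕ → ℂ) (α β κ q : ℂ) (h1 : s 1 = κ) (h2 : s 2 = 2 * q - κ ^ 2)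
    (h3 : ∀ n, 3 ≤ n → s n = -κ * s (n - 1) - q * s (n - 2)) (hs : α + β = -κ) (hp : α * β = q) (n : ℕ) (hn : 1 ≤ n) :
    s n = -(α ^ n + β ^ n) := by
  have hκ : κ = -(α + β) := by rw [hs]; ring
  induction n using Nat.strong_induction_on with
  | _ n ih =>
    rcases Nat.lt_or_ge n 3 with h | h
    · have : n = 1 ∨ n = 2 := by omega
      rcases this with rfl | rfl
      · rw [h1, hκ]; ring
      · rw [h2, hκ, ← hp]; ring
    · obtain ⟨k, rfl⟩ : ∃ k, n = k + 3 := ⟨n - 3, by omega⟩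
      rw [h3 _ h, ih _ (by omega) (by omega), ih _ (by omega) (by omega)]
      have e1 : k + 3 - 1 = k + 2 := by omega
      have e2 : k + 3 - 2 = k + 1 := by omega
      rw [e1, e2, hκ, ← hp]
      ring

theorem kl_quad (κ q : ℂ) : ∃ α β : ℂ, α + β = -κ ∧ α * β = q := by
  obtain ⟨z, hz⟩ := IsAlgClosed.exists_pow_nat_eq (κ ^ 2 - 4 * q) (n := 2) (by norm_num)
  refine ⟨(-κ + z) / 2, (-κ - z) / 2, by ring, ?_⟩
  linear_combination (-1 / 4) * hz

open Classical in
/-- Weil bound for Kloosterman sums -/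
theorem kl_weil (hq : Odd (Fintype.card F)) (ψ : AddChar F ℂ) (hψ : ψ ≠ 1) (a b : F) (ha : a ≠ 0) (hb : b ≠ 0) :
    ‖∑ s ∈ Finset.univ.erase (0 : F), ψ (a * s + b * s⁻¹)‖ ≤ 2 * √(Fintype.card F) := by
  have hconv := kl_conv (K := AlgebraicClosure F) ψ a b
  have hA0 := klA_zero ψ a b
  have hA2 := klA_two ψ hψ a b ha hb
  have hA3 := klA_big ψ hψ a b ha
  rw [← klA_one]
  set κ := klA ψ a b 1 with hκ
  set s := klS F (AlgebraicClosure F) ψ a b with hs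
  obtain ⟨α, β, hsum, hprod⟩ := kl_quad κ (Fintype.card F)
  have h1 : s 1 = κ := by
    have := hconv 1
    simp [hA0] at this
    rw [← this]
  have h2 : s 2 = 2 * (Fintype.card F : ℂ) - κ ^ 2 := by
    have := hconv 2
    rw [Finset.sum_Icc_succ_top (by norm_num)] at this
    simp [hA0, hA2] at this
    rw [h1, ← hκ] at this
    rw [this]
    ring
  have h3 : ∀ n, 3 ≤ n → s n = -κ * s (n - 1) - (Fintype.card F : ℂ) * s (n - 2) := by
    intro n hn
    obtain ⟨k, rfl⟩ : ∃ k, n = k + 3 := ⟨n - 3, by omega⟩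
    have := hconv (k + 3)
    rw [hA3 _ hn, Finset.sum_Icc_succ_top (by omega), Finset.sum_Icc_succ_top (by omega), Finset.sum_Icc_succ_top (by omega),
      Finset.sum_eq_zero] at this
    · have e1 : k + 3 - 1 = k + 2 := by omega
      have e2 : k + 3 - 2 = k + 1 := by omega
      have e3 : k + 2 + 1 - (k + 2 + 1) = 0 := by omega
      have e4 : k + 2 + 1 - (k + 1 + 1) = 1 := by omega
      have e5 : k + 2 + 1 - (k + 1) = 2 := by omega
      rw [e1, e2]
      simp only [e3, e4, e5, hA0, hA2, ← hκ, ← hs] at this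
      linear_combination -this
    · intro j hj
      rw [Finset.mem_Icc] at hj
      rw [hA3 _ (by omega), mul_zero]
  have hform := kl_rec s α β κ _ h1 h2 h3 hsum hprod
  have hqpos : (0 : ℝ) < Fintype.card F := by exact_mod_cast Fintype.card_pos
  have hb : ∀ m : ℕ, 3 ≤ m → ‖α ^ (2 * m) + β ^ (2 * m)‖ ≤ (6 * Fintype.card F + 9) * (Fintype.card F : ℝ) ^ m := by
    intro m hm
    have := klS_bound (K := AlgebraicClosure F) hq ψ hψ a b ha hb m hm
    rw [← hs, hform _ (by omega), norm_neg] at this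
    exact this
  have hα := kl_abs α β (Fintype.card F) _ hqpos (by rw [hprod]; simp) hb
  have hβ := kl_abs β α (Fintype.card F) _ hqpos (by rw [mul_comm, hprod]; simp) (fun m hm => by rw [add_comm]; exact hb m hm)
  have : κ = -(α + β) := by rw [hsum]; ring
  rw [this, norm_neg]
  linarith [norm_add_le α β]


theorem hg_sum2 {M : Type*} [AddCommMonoid M] (f : (Fin 2 → F) → M) :
    ∑ x : Fin 2 → F, f x = ∑ u : F, ∑ v : F, f ![u, v] := by
  rw [← Fintype.sum_prod_type', ← (finTwoArrowEquiv F).symm.sum_comp]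
  rfl

open Classical in
theorem hg_orth (ψ : AddChar F ℂ) (hψ : ψ.IsPrimitive) (ξ : Fin 2 → F) :
    ∑ x : Fin 2 → F, ψ (ξ ⬝ᵥ x) = if ξ = 0 then (Fintype.card F : ℂ) ^ 2 else 0 := by
  rw [hg_sum2]
  have : ∀ u v : F, ψ (ξ ⬝ᵥ ![u, v]) = ψ (u * ξ 0) * ψ (v * ξ 1) := by
    intro u v
    rw [← AddChar.map_add_eq_mul]
    congr 1
    simp [dotProduct, Fin.sum_univ_two]
    ring
  simp only [this, ← Finset.mul_sum]
  rw [← Finset.sum_mul, AddChar.sum_mulShift _ hψ, AddChar.sum_mulShift _ hψ]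
  have h0 : ξ = 0 ↔ ξ 0 = 0 ∧ ξ 1 = 0 := by
    constructor
    · rintro rfl; simp
    · rintro ⟨h1, h2⟩
      ext i
      fin_cases i
      · exact h1
      · exact h2
  by_cases h1 : ξ 0 = 0 <;> by_cases h2 : ξ 1 = 0 <;> simp [h0, h1, h2, sq]

theorem hg_parseval (ψ : AddChar F ℂ) (hψ : ψ.IsPrimitive) (c : (Fin 2 → F) → ℂ) :
    ∑ x : Fin 2 → F, ‖∑ ξ, c ξ * ψ (ξ ⬝ᵥ x)‖ ^ 2 = (Fintype.card F : ℝ) ^ 2 * ∑ ξ, ‖c ξ‖ ^ 2 := by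
  classical
  have h : ∀ z : ℂ, ((‖z‖ ^ 2 : ℝ) : ℂ) = z * (starRingEnd ℂ) z := by
    intro z; rw [Complex.mul_conj, Complex.normSq_eq_norm_sq]
  have hc : (∑ x : Fin 2 → F, ‖∑ ξ, c ξ * ψ (ξ ⬝ᵥ x)‖ ^ 2 : ℝ) = ((Fintype.card F : ℂ) ^ 2 * ∑ ξ, (‖c ξ‖ ^ 2 : ℝ) : ℂ) := by
    push_cast
    have e1 : ∀ x : Fin 2 → F, ((‖∑ ξ, c ξ * ψ (ξ ⬝ᵥ x)‖ : ℂ)) ^ 2 = ∑ ξ, ∑ ζ, c ξ * (starRingEnd ℂ) (c ζ) * ψ ((ξ - ζ) ⬝ᵥ x) := by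
      intro x
      rw [← Complex.ofReal_pow, h, map_sum, Finset.sum_mul_sum]
      apply Finset.sum_congr rfl; intro ξ _
      apply Finset.sum_congr rfl; intro ζ _
      rw [map_mul, sub_dotProduct, sub_eq_add_neg, AddChar.map_add_eq_mul, AddChar.map_neg_eq_conj]
      ring
    rw [Finset.sum_congr rfl (fun x _ => e1 x), Finset.sum_comm, Finset.mul_sum]
    apply Finset.sum_congr rfl; intro ξ _
    rw [Finset.sum_comm]
    simp only [← Finset.mul_sum, hg_orth ψ hψ, sub_eq_zero]
    simp only [mul_ite, mul_zero, Finset.sum_ite_eq, Finset.mem_univ, if_true]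
    rw [← Complex.ofReal_pow, h]
    ring
  exact_mod_cast hc

theorem hg_gauss (hq : Odd (Fintype.card F)) : ∃ e : ℂ, ‖e‖ = 1 ∧ ∀ ψ : AddChar F ℂ, ψ.IsPrimitive →
    (∑ u : F, ψ (u ^ 2)) ^ 2 = e * Fintype.card F := by
  classical
  have h2 : ringChar F ≠ 2 := by
    intro h
    apply kl_two_ne hq
    have := ringChar.Nat.cast_ringChar (R := F)
    rw [h] at this
    exact_mod_cast this
  set η := (quadraticChar F).ringHomComp (Int.castRingHom ℂ) with hη
  have hη1 : η ≠ 1 := by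
    rw [hη, MulChar.ringHomComp_ne_one_iff (RingHom.injective_int _)]
    exact quadraticChar_ne_one h2
  have hηq : η.IsQuadratic := (quadraticChar_isQuadratic F).comp _
  refine ⟨η (-1), ?_, ?_⟩
  · rcases hηq (-1) with h | h | h
    · exfalso
      have : IsUnit (η (-1)) := (isUnit_one.neg).map η
      rw [h] at this
      exact not_isUnit_zero this
    · rw [h]; simp
    · rw [h]; simp
  · intro ψ hψ
    rw [← gaussSum_sq hη1 hηq hψ]
    congr 1
    have hη0 : ∑ t : F, ψ t = 0 := by
      have := AddChar.sum_mulShift (ψ := ψ) 1 hψ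
      simpa using this
    have e1 : ∑ u : F, ψ (u ^ 2) = ∑ t : F, ∑ u : F, if u ^ 2 = t then ψ t else 0 := by
      rw [Finset.sum_comm]
      simp
    have e2 : ∀ t : F, (∑ u : F, if u ^ 2 = t then ψ t else 0) = η t * ψ t + ψ t := by
      intro t
      rw [← Finset.sum_filter, Finset.sum_const, nsmul_eq_mul]
      have := quadraticChar_card_sqrts h2 t
      have h3 : ((Finset.univ.filter (fun u : F => u ^ 2 = t)).card : ℤ) = quadraticChar F t + 1 := by
        rw [← this]
        congr 2
        ext u
        simp
      have h4 : ((Finset.univ.filter (fun u : F => u ^ 2 = t)).card : ℂ) = η t + 1 := by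
        rw [hη]
        simp only [MulChar.ringHomComp_apply, eq_intCast]
        exact_mod_cast h3
      rw [h4]
      ring
    rw [e1, Finset.sum_congr rfl (fun t _ => e2 t), Finset.sum_add_distrib, hη0, add_zero]
    rfl


theorem hg_quad (hq : Odd (Fintype.card F)) (ψ : AddChar F ℂ) (s c : F) (hs : s ≠ 0) :
    ∑ u : F, ψ (s * u ^ 2 + c * u) = ψ (-c ^ 2 / (4 * s)) * ∑ u : F, ψ (s * u ^ 2) := by
  have h2 := kl_two_ne hq
  rw [← (Equiv.subRight (c / (2 * s))).sum_comp, Finset.mul_sum]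
  apply Finset.sum_congr rfl
  intro u _
  rw [← AddChar.map_add_eq_mul]
  congr 1
  simp only [Equiv.subRight_apply]
  have h4 : (4 : F) ≠ 0 := by
    have : (4 : F) = 2 * 2 := by norm_num
    rw [this]; exact mul_ne_zero h2 h2
  field_simp
  ring

open Classical in
/-- circle -/
noncomputable def hgC (a : F) : Finset (Fin 2 → F) := Finset.univ.filter (fun x => fnorm x = a)

open Classical in
theorem hg_circle_eq (hq : Odd (Fintype.card F)) : ∃ e : ℂ, ‖e‖ = 1 ∧ ∀ ψ : AddChar F ℂ, ψ.IsPrimitive →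
    ∀ (a : F) (ξ : Fin 2 → F), ∑ x ∈ hgC a, ψ (ξ ⬝ᵥ x) =
      (if ξ = 0 then (Fintype.card F : ℂ) else 0) + e * ∑ s ∈ Finset.univ.erase (0 : F), ψ (-a * s + (-(fnorm ξ) / 4) * s⁻¹) := by
  obtain ⟨e, he, hg⟩ := hg_gauss (F := F) hq
  refine ⟨e, he, ?_⟩
  intro ψ hψ a ξ
  have hq0 : (Fintype.card F : ℂ) ≠ 0 := by exact_mod_cast Fintype.card_ne_zero
  have h1 : (Fintype.card F : ℂ) * ∑ x ∈ hgC a, ψ (ξ ⬝ᵥ x) = ∑ s : F, ∑ x : Fin 2 → F, ψ (s * (fnorm x - a)) * ψ (ξ ⬝ᵥ x) := by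
    rw [Finset.sum_comm, hgC, Finset.sum_filter, Finset.mul_sum]
    apply Finset.sum_congr rfl
    intro x _
    rw [← Finset.sum_mul, AddChar.sum_mulShift _ hψ]
    simp only [sub_eq_zero]
    split_ifs <;> simp
  have h2 : ∀ s : F, s ≠ 0 → ∑ x : Fin 2 → F, ψ (s * (fnorm x - a)) * ψ (ξ ⬝ᵥ x) =
      e * Fintype.card F * ψ (-a * s + (-(fnorm ξ) / 4) * s⁻¹) := by
    intro s hs
    have hp : (AddChar.mulShift ψ s).IsPrimitive := by
      apply AddChar.IsPrimitive.of_ne_one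
      exact hψ hs
    have hgs := hg _ hp
    simp only [AddChar.mulShift_apply] at hgs
    rw [hg_sum2]
    have h3 : ∀ u v : F, ψ (s * (fnorm ![u, v] - a)) * ψ (ξ ⬝ᵥ ![u, v]) =
        ψ (-a * s) * (ψ (s * u ^ 2 + ξ 0 * u) * ψ (s * v ^ 2 + ξ 1 * v)) := by
      intro u v
      rw [← AddChar.map_add_eq_mul, ← AddChar.map_add_eq_mul, ← AddChar.map_add_eq_mul]
      congr 1
      simp [fnorm, dotProduct, Fin.sum_univ_two]
      ring
    simp only [h3, ← Finset.mul_sum]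
    rw [← Finset.sum_mul, hg_quad hq ψ s _ hs, hg_quad hq ψ s _ hs]
    have h4 : -a * s + (-(fnorm ξ) / 4) * s⁻¹ = -a * s + (-(ξ 0) ^ 2 / (4 * s) + -(ξ 1) ^ 2 / (4 * s)) := by
      unfold fnorm
      have h2 := kl_two_ne hq
      have h4 : (4 : F) ≠ 0 := by
        have : (4 : F) = 2 * 2 := by norm_num
        rw [this]; exact mul_ne_zero h2 h2
      field_simp
      ring
    rw [h4, AddChar.map_add_eq_mul, AddChar.map_add_eq_mul, ← hgs]
    ring
  have h0 : ∑ x : Fin 2 → F, ψ (0 * (fnorm x - a)) * ψ (ξ ⬝ᵥ x) = if ξ = 0 then (Fintype.card F : ℂ) ^ 2 else 0 := by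
    simp only [zero_mul, AddChar.map_zero_eq_one, one_mul]
    exact hg_orth ψ hψ ξ
  apply mul_left_cancel₀ hq0
  rw [h1, ← Finset.sum_erase_add _ _ (Finset.mem_univ (0 : F)), h0,
    Finset.sum_congr rfl (fun s hs => h2 s (Finset.ne_of_mem_erase hs)), ← Finset.mul_sum]
  split_ifs <;> ring

open Classical in
theorem hg_circle (hq : Odd (Fintype.card F)) (ψ : AddChar F ℂ) (hψ : ψ.IsPrimitive) (a : F) (ha : a ≠ 0) (ξ : Fin 2 → F) :
    ‖∑ x ∈ hgC a, ψ (ξ ⬝ᵥ x) - (if ξ = 0 then (Fintype.card F : ℂ) else 0)‖ ≤ 2 * √(Fintype.card F) := by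
  obtain ⟨e, he, h⟩ := hg_circle_eq (F := F) hq
  rw [h ψ hψ, add_sub_cancel_left, norm_mul, he, one_mul]
  have hψ1 : ψ ≠ 1 := by
    have := hψ one_ne_zero
    rwa [AddChar.mulShift_one] at this
  by_cases hξ : fnorm ξ = 0
  · rw [hξ]
    have h1 : ∑ s : F, ψ (-a * s) = 0 := by
      have := AddChar.sum_mulShift (ψ := ψ) (-a) hψ
      rw [if_neg (neg_ne_zero.mpr ha)] at this
      rw [Finset.sum_congr rfl (fun s _ => by rw [mul_comm])]
      exact_mod_cast this
    rw [← Finset.sum_erase_add _ _ (Finset.mem_univ (0 : F))] at h1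
    have h2 : ∑ s ∈ Finset.univ.erase (0 : F), ψ (-a * s + (-0 / 4) * s⁻¹) = -1 := by
      simp only [neg_zero, zero_div, zero_mul, add_zero]
      simp only [mul_zero, AddChar.map_zero_eq_one] at h1
      linear_combination h1
    rw [h2]
    simp only [norm_neg, norm_one]
    have : (1 : ℝ) ≤ √(Fintype.card F) := by
      rw [Real.one_le_sqrt]
      exact_mod_cast Fintype.card_pos
    linarith
  · apply kl_weil hq ψ hψ1
    · exact neg_ne_zero.mpr ha
    · have h2 := kl_two_ne hq
      have h4 : (4 : F) ≠ 0 := by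
        have : (4 : F) = 2 * 2 := by norm_num
        rw [this]; exact mul_ne_zero h2 h2
      exact div_ne_zero (neg_ne_zero.mpr hξ) h4

open Classical in
/-- number of y in E on the circle around x -/
noncomputable def hgD (E : Finset (Fin 2 → F)) (a : F) (x : Fin 2 → F) : ℕ :=
  (E.filter (fun y => fnorm (x - y) = a)).card

theorem hg_inv_prim (ψ : AddChar F ℂ) (hψ : ψ.IsPrimitive) : (ψ⁻¹).IsPrimitive := by
  apply AddChar.IsPrimitive.of_ne_one
  have := hψ one_ne_zero
  rw [AddChar.mulShift_one] at this
  simpa using this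

theorem hg_fourier (ψ : AddChar F ℂ) (hψ : ψ.IsPrimitive) (E : Finset (Fin 2 → F)) (a : F) (x : Fin 2 → F) :
    ∑ ξ : Fin 2 → F, (∑ w ∈ hgC a, ψ⁻¹ (ξ ⬝ᵥ w)) * (∑ y ∈ E, ψ⁻¹ (ξ ⬝ᵥ y)) * ψ (ξ ⬝ᵥ x) =
      (Fintype.card F : ℂ) ^ 2 * hgD E a x := by
  classical
  have h1 : ∀ ξ : Fin 2 → F, (∑ w ∈ hgC a, ψ⁻¹ (ξ ⬝ᵥ w)) * (∑ y ∈ E, ψ⁻¹ (ξ ⬝ᵥ y)) * ψ (ξ ⬝ᵥ x) =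
      ∑ w ∈ hgC a, ∑ y ∈ E, ψ ((x - y - w) ⬝ᵥ ξ) := by
    intro ξ
    rw [Finset.sum_mul_sum, Finset.sum_mul]
    apply Finset.sum_congr rfl; intro w _
    rw [Finset.sum_mul]
    apply Finset.sum_congr rfl; intro y _
    rw [AddChar.inv_apply, AddChar.inv_apply, ← AddChar.map_add_eq_mul, ← AddChar.map_add_eq_mul,
      dotProduct_comm (x - y - w), dotProduct_sub, dotProduct_sub]
    congr 1
    ring
  rw [Finset.sum_congr rfl (fun ξ _ => h1 ξ), Finset.sum_comm]
  rw [Finset.sum_congr rfl (fun w _ => Finset.sum_comm)]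
  simp only [hg_orth ψ hψ]
  rw [Finset.sum_comm]
  unfold hgD
  rw [Finset.card_filter]
  push_cast
  rw [Finset.mul_sum]
  apply Finset.sum_congr rfl
  intro y _
  have : ∀ w : Fin 2 → F, (x - y - w = 0) ↔ (x - y = w) := fun w => sub_eq_zero
  simp only [this, Finset.sum_ite_eq, hgC, Finset.mem_filter, Finset.mem_univ, true_and]
  split_ifs <;> simp

theorem hg_var (hq : Odd (Fintype.card F)) (E : Finset (Fin 2 → F)) (a : F) (ha : a ≠ 0) :
    ∑ x : Fin 2 → F, ((hgD E a x : ℝ) - (hgC a).card * E.card / (Fintype.card F : ℝ) ^ 2) ^ 2 ≤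
      4 * Fintype.card F * E.card := by
  classical
  obtain ⟨ψ, hψ⟩ : ∃ ψ : AddChar F ℂ, ψ.IsPrimitive :=
    ⟨_, AddChar.FiniteField.primitiveChar_to_Complex_isPrimitive F⟩
  have hχ := hg_inv_prim ψ hψ
  set q := Fintype.card F with hqdef
  have hq0 : (0 : ℝ) < q := by exact_mod_cast Fintype.card_pos
  have hq0c : (q : ℂ) ≠ 0 := by exact_mod_cast Fintype.card_ne_zero
  set T : (Fin 2 → F) → ℂ := fun ξ => ∑ w ∈ hgC a, ψ⁻¹ (ξ ⬝ᵥ w) with hT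
  set G : (Fin 2 → F) → ℂ := fun ξ => ∑ y ∈ E, ψ⁻¹ (ξ ⬝ᵥ y) with hG
  set c : (Fin 2 → F) → ℂ := fun ξ => if ξ = 0 then 0 else T ξ * G ξ with hc
  have hT0 : T 0 = (hgC a).card := by simp [hT]
  have hG0 : G 0 = E.card := by simp [hG]
  have h1 : ∀ x : Fin 2 → F, ∑ ξ, c ξ * ψ (ξ ⬝ᵥ x) =
      (((q : ℝ) ^ 2 * ((hgD E a x : ℝ) - (hgC a).card * E.card / (q : ℝ) ^ 2) : ℝ) : ℂ) := by
    intro x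
    have h2 := hg_fourier ψ hψ E a x
    rw [← Finset.sum_erase_add _ _ (Finset.mem_univ (0 : Fin 2 → F))] at h2 ⊢
    have e1 : c 0 * ψ (0 ⬝ᵥ x) = 0 := by simp [hc]
    have e2 : ∑ ξ ∈ Finset.univ.erase 0, c ξ * ψ (ξ ⬝ᵥ x) = ∑ ξ ∈ Finset.univ.erase 0, T ξ * G ξ * ψ (ξ ⬝ᵥ x) := by
      apply Finset.sum_congr rfl
      intro ξ hξ
      rw [hc]
      simp only [if_neg (Finset.ne_of_mem_erase hξ)]
    rw [e1, e2, add_zero]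
    have e3 : T 0 * G 0 * ψ (0 ⬝ᵥ x) = (hgC a).card * E.card := by rw [hT0, hG0]; simp
    change _ + T 0 * G 0 * ψ (0 ⬝ᵥ x) = _ at h2
    rw [e3] at h2
    push_cast
    rw [mul_sub, mul_div_cancel₀ _ (pow_ne_zero 2 hq0c)]
    exact eq_sub_of_add_eq h2
  have hP := hg_parseval ψ hψ c
  simp only [h1, Complex.norm_real, Real.norm_eq_abs, sq_abs, mul_pow] at hP
  rw [← Finset.mul_sum] at hP
  have hPG : ∑ ξ, ‖G ξ‖ ^ 2 = (q : ℝ) ^ 2 * E.card := by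
    have := hg_parseval ψ⁻¹ hχ (fun y => if y ∈ E then 1 else 0)
    simp only [ite_mul, one_mul, zero_mul, Finset.sum_ite_mem, Finset.univ_inter] at this
    rw [Finset.sum_congr rfl (g := fun ξ => ‖∑ y ∈ E, ψ⁻¹ (y ⬝ᵥ ξ)‖ ^ 2)
      (fun ξ _ => by rw [hG]; simp only [dotProduct_comm ξ]), this]
    congr 1
    rw [Finset.sum_congr rfl (g := fun y => if y ∈ E then (1 : ℝ) else 0) (fun y _ => by split_ifs <;> simp)]
    simp
  have hcb : ∑ ξ, ‖c ξ‖ ^ 2 ≤ 4 * q * ∑ ξ, ‖G ξ‖ ^ 2 := by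
    rw [Finset.mul_sum]
    apply Finset.sum_le_sum
    intro ξ _
    by_cases hξ : ξ = 0
    · rw [hc]; simp only [if_pos hξ]
      rw [norm_zero, zero_pow two_ne_zero]
      positivity
    · have h3 := hg_circle hq ψ⁻¹ hχ a ha ξ
      rw [if_neg hξ, sub_zero] at h3
      change ‖T ξ‖ ≤ _ at h3
      rw [hc]; simp only [if_neg hξ]
      rw [norm_mul, mul_pow]
      apply mul_le_mul_of_nonneg_right _ (by positivity)
      calc ‖T ξ‖ ^ 2 ≤ (2 * √(q : ℝ)) ^ 2 := pow_le_pow_left₀ (norm_nonneg _) h3 2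
        _ = 4 * q := by rw [mul_pow, Real.sq_sqrt hq0.le]; norm_num
  rw [hPG] at hcb
  have hpos : (0 : ℝ) < ((q : ℝ) ^ 2) ^ 2 := by positivity
  refine le_of_mul_le_mul_left ?_ hpos
  rw [hP]
  calc (q : ℝ) ^ 2 * ∑ ξ, ‖c ξ‖ ^ 2 ≤ (q : ℝ) ^ 2 * (4 * q * ((q : ℝ) ^ 2 * E.card)) := by gcongr
    _ = _ := by ring

theorem hg_card (hq : Odd (Fintype.card F)) (a : F) (ha : a ≠ 0) :
    |((hgC a).card : ℝ) - Fintype.card F| ≤ 2 * √(Fintype.card F) := by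
  classical
  have h := hg_circle hq _ (AddChar.FiniteField.primitiveChar_to_Complex_isPrimitive F) a ha 0
  simp only [zero_dotProduct, AddChar.map_zero_eq_one, Finset.sum_const, if_true, nsmul_eq_mul, mul_one] at h
  have e : ((hgC a).card : ℂ) - (Fintype.card F : ℂ) = (((hgC a).card - Fintype.card F : ℝ) : ℂ) := by push_cast; rfl
  rw [e, Complex.norm_real, Real.norm_eq_abs] at h
  exact h

theorem hg_var2 (hq : Odd (Fintype.card F)) (E : Finset (Fin 2 → F)) (a : F) (ha : a ≠ 0) :
    ∑ x ∈ E, ((hgD E a x : ℝ) - E.card / (Fintype.card F : ℝ)) ^ 2 ≤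
      8 * Fintype.card F * E.card + 8 * (E.card : ℝ) ^ 3 / (Fintype.card F : ℝ) ^ 3 := by
  have h1 := hg_var hq E a ha
  have h2 := hg_card hq a ha
  set q := (Fintype.card F : ℝ) with hqdef
  have hq0 : (0 : ℝ) < q := by rw [hqdef]; exact_mod_cast Fintype.card_pos
  set M := (E.card : ℝ) with hM
  set c := ((hgC a).card : ℝ) with hc
  have hM0 : 0 ≤ M := by positivity
  have h3 : ∑ x ∈ E, ((hgD E a x : ℝ) - c * M / q ^ 2) ^ 2 ≤ 4 * q * M :=
    le_trans (Finset.sum_le_sum_of_subset_of_nonneg (Finset.subset_univ E) (fun _ _ _ => sq_nonneg _)) h1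
  have h4 : (c * M / q ^ 2 - M / q) ^ 2 ≤ 4 * M ^ 2 / q ^ 3 := by
    have e : c * M / q ^ 2 - M / q = (c - q) * (M / q ^ 2) := by field_simp
    rw [e, mul_pow]
    have h5 : (c - q) ^ 2 ≤ 4 * q := by
      rw [← sq_abs]
      calc |c - q| ^ 2 ≤ (2 * √q) ^ 2 := pow_le_pow_left₀ (abs_nonneg _) h2 2
        _ = 4 * q := by rw [mul_pow, Real.sq_sqrt hq0.le]; norm_num
    calc (c - q) ^ 2 * (M / q ^ 2) ^ 2 ≤ 4 * q * (M / q ^ 2) ^ 2 := by gcongr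
      _ = _ := by field_simp
  have h6 : ∀ x ∈ E, ((hgD E a x : ℝ) - M / q) ^ 2 ≤ 2 * ((hgD E a x : ℝ) - c * M / q ^ 2) ^ 2 + 2 * (4 * M ^ 2 / q ^ 3) := by
    intro x _
    nlinarith [sq_nonneg (((hgD E a x : ℝ) - c * M / q ^ 2) - (c * M / q ^ 2 - M / q))]
  refine le_trans (Finset.sum_le_sum h6) ?_
  rw [Finset.sum_add_distrib, ← Finset.mul_sum, Finset.sum_const, nsmul_eq_mul, ← hM]
  have e7 : M * (2 * (4 * M ^ 2 / q ^ 3)) = 8 * M ^ 3 / q ^ 3 := by ring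
  rw [e7]
  linarith

theorem hg_final (hq : Odd (Fintype.card F)) (E : Finset (Fin 2 → F)) (a b : F) (ha : a ≠ 0) (hb : b ≠ 0)
    (K : ℝ) (hK : 1 ≤ K) (hE : K * (Fintype.card F : ℝ) ^ ((3 : ℝ) / 2) ≤ (E.card : ℝ)) :
    |∑ x ∈ E, (hgD E a x : ℝ) * (hgD E b x : ℝ) - (E.card : ℝ) ^ 3 / (Fintype.card F : ℝ) ^ 2| ≤
      24 / K * ((E.card : ℝ) ^ 3 / (Fintype.card F : ℝ) ^ 2) := by
  have h1 := hg_var2 hq E a ha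
  have h2 := hg_var2 hq E b hb
  have hEq : (E.card : ℝ) ≤ (Fintype.card F : ℝ) ^ 2 := by
    have := Finset.card_le_univ E
    rw [Fintype.card_fun, Fintype.card_fin] at this
    exact_mod_cast this
  set q := (Fintype.card F : ℝ) with hqdef
  have hq0 : (0 : ℝ) < q := by rw [hqdef]; exact_mod_cast Fintype.card_pos
  set M := (E.card : ℝ) with hM
  have hK0 : 0 < K := by linarith
  have hr0 : 0 < q ^ ((3 : ℝ) / 2) := Real.rpow_pos_of_pos hq0 _
  have hM0 : 0 < M := lt_of_lt_of_le (by positivity) hE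
  have hsq : (q ^ ((3 : ℝ) / 2)) ^ 2 = q ^ 3 := by
    rw [← Real.rpow_natCast, ← Real.rpow_mul hq0.le, ← Real.rpow_natCast]
    norm_num
  have hM2 : K ^ 2 * q ^ 3 ≤ M ^ 2 := by
    rw [← hsq, ← mul_pow]
    exact pow_le_pow_left₀ (by positivity) hE 2
  have hqK : K ^ 2 ≤ q := by
    have h3 : M ^ 2 ≤ q ^ 4 := by
      calc M ^ 2 ≤ (q ^ 2) ^ 2 := pow_le_pow_left₀ hM0.le hEq 2
        _ = q ^ 4 := by ring
    have h4 : q ^ 3 * K ^ 2 ≤ q ^ 3 * q := by linarith [hM2, h3, (by ring : q ^ 3 * q = q ^ 4)]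
    exact le_of_mul_le_mul_left h4 (by positivity)
  set W := M ^ 3 / q ^ 2 with hW
  have hW0 : 0 < W := by positivity
  have hV : 8 * q * M + 8 * M ^ 3 / q ^ 3 ≤ 16 / K ^ 2 * W := by
    have e1 : q * M ≤ W / K ^ 2 := by
      rw [hW, div_div, le_div_iff₀ (by positivity)]
      calc q * M * (q ^ 2 * K ^ 2) = M * (K ^ 2 * q ^ 3) := by ring
        _ ≤ M * M ^ 2 := by gcongr
        _ = M ^ 3 := by ring
    have e2 : M ^ 3 / q ^ 3 ≤ W / K ^ 2 := by
      rw [hW, div_div]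
      apply div_le_div_of_nonneg_left (by positivity) (by positivity)
      calc q ^ 2 * K ^ 2 ≤ q ^ 2 * q := by gcongr
        _ = q ^ 3 := by ring
    have e3 : 8 * M ^ 3 / q ^ 3 = 8 * (M ^ 3 / q ^ 3) := by ring
    have e4 : 16 / K ^ 2 * W = 16 * (W / K ^ 2) := by ring
    rw [e3, e4]
    linarith
  have e5 : W = ∑ x ∈ E, (M / q) ^ 2 := by
    rw [Finset.sum_const, nsmul_eq_mul, ← hM, hW]
    ring
  have e6 : ∑ x ∈ E, (hgD E a x : ℝ) * (hgD E b x : ℝ) - W =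
      ∑ x ∈ E, ((hgD E a x : ℝ) * (hgD E b x : ℝ) - (M / q) ^ 2) := by
    rw [Finset.sum_sub_distrib, ← e5]
  rw [e6]
  have key : ∀ A B m : ℝ, |A * B - m ^ 2| ≤ 4 / K * m ^ 2 + (K / 8 + 1 / 2) * ((A - m) ^ 2 + (B - m) ^ 2) := by
    intro A B m
    have i1 : ∀ r : ℝ, |m * r| ≤ 2 / K * m ^ 2 + K / 8 * r ^ 2 := by
      intro r
      have hk : 2 / K * m ^ 2 + K / 8 * r ^ 2 - m * r = 1 / (8 * K) * (4 * m - K * r) ^ 2 := by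
        field_simp
        ring
      have hk2 : 2 / K * m ^ 2 + K / 8 * r ^ 2 + m * r = 1 / (8 * K) * (4 * m + K * r) ^ 2 := by
        field_simp
        ring
      have p1 : 0 ≤ 1 / (8 * K) * (4 * m - K * r) ^ 2 := by positivity
      have p2 : 0 ≤ 1 / (8 * K) * (4 * m + K * r) ^ 2 := by positivity
      rw [abs_le]
      constructor <;> linarith
    have i2 : |(A - m) * (B - m)| ≤ 1 / 2 * ((A - m) ^ 2 + (B - m) ^ 2) := by
      rw [abs_le]
      constructor <;> nlinarith [sq_nonneg ((A - m) - (B - m)), sq_nonneg ((A - m) + (B - m))]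
    have i3 : A * B - m ^ 2 = m * (A - m) + m * (B - m) + (A - m) * (B - m) := by ring
    rw [i3]
    have j1 := i1 (A - m)
    have j2 := i1 (B - m)
    have j3 := abs_add_three (m * (A - m)) (m * (B - m)) ((A - m) * (B - m))
    have j4 : 4 / K * m ^ 2 = 2 / K * m ^ 2 + 2 / K * m ^ 2 := by ring
    rw [j4]
    linarith
  refine le_trans (Finset.abs_sum_le_sum_abs _ _) ?_
  refine le_trans (Finset.sum_le_sum (fun x _ => key _ _ _)) ?_
  rw [Finset.sum_add_distrib, ← Finset.mul_sum, ← Finset.mul_sum, ← e5, Finset.sum_add_distrib]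
  have h5 : (K / 8 + 1 / 2) * (∑ x ∈ E, ((hgD E a x : ℝ) - M / q) ^ 2 + ∑ x ∈ E, ((hgD E b x : ℝ) - M / q) ^ 2) ≤
      (K / 8 + 1 / 2) * (16 / K ^ 2 * W + 16 / K ^ 2 * W) := by
    apply mul_le_mul_of_nonneg_left _ (by positivity)
    linarith
  have h6 : (K / 8 + 1 / 2) * (16 / K ^ 2 * W + 16 / K ^ 2 * W) = 4 / K * W + 16 / K ^ 2 * W := by
    field_simp
    ring
  have h7 : 16 / K ^ 2 * W ≤ 16 / K * W := by
    apply mul_le_mul_of_nonneg_right _ hW0.le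
    apply div_le_div_of_nonneg_left (by norm_num) hK0
    nlinarith
  have h8 : 24 / K * W = 4 / K * W + 4 / K * W + 16 / K * W := by ring
  linarith

theorem hg_count (E : Finset (Fin 2 → F)) (a b : F) :
    (Set.ncard {t : (Fin 2 → F) × (Fin 2 → F) × (Fin 2 → F) |
                  t.1 ∈ (E : Set (Fin 2 → F)) ∧ t.2.1 ∈ (E : Set (Fin 2 → F)) ∧ t.2.2 ∈ (E : Set (Fin 2 → F)) ∧
                  fnorm (t.1 - t.2.1) = a ∧ fnorm (t.1 - t.2.2) = b} : ℝ) =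
      ∑ x ∈ E, (hgD E a x : ℝ) * (hgD E b x : ℝ) := by
  classical
  have h : {t : (Fin 2 → F) × (Fin 2 → F) × (Fin 2 → F) |
                  t.1 ∈ (E : Set (Fin 2 → F)) ∧ t.2.1 ∈ (E : Set (Fin 2 → F)) ∧ t.2.2 ∈ (E : Set (Fin 2 → F)) ∧
                  fnorm (t.1 - t.2.1) = a ∧ fnorm (t.1 - t.2.2) = b} =
      (((E ×ˢ (E ×ˢ E)).filter (fun t => fnorm (t.1 - t.2.1) = a ∧ fnorm (t.1 - t.2.2) = b) :
        Finset ((Fin 2 → F) × (Fin 2 → F) × (Fin 2 → F))) : Set _) := by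
    ext t
    simp only [Finset.mem_coe, Set.mem_ofPred_eq, Finset.coe_filter, Finset.mem_product]
    tauto
  rw [h, Set.ncard_coe_finset, Finset.card_filter, Finset.sum_product]
  push_cast
  apply Finset.sum_congr rfl
  intro x _
  unfold hgD
  rw [Finset.card_filter, Finset.card_filter, Finset.sum_product]
  push_cast
  rw [Finset.sum_mul_sum]
  apply Finset.sum_congr rfl; intro y _
  apply Finset.sum_congr rfl; intro z _
  by_cases h1 : fnorm (x - y) = a <;> by_cases h2 : fnorm (x - z) = b <;> simp [h1, h2]

end

end

theorem stmt_4 (ε : ℝ) (hε : 0 < ε) :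
    ∃ K > (0 : ℝ),
      ∀ (F : Type) [Field F] [Fintype F], Odd (Fintype.card F) →
        ∀ (E : Set (Fin 2 → F)),
          K * (Fintype.card F : ℝ) ^ ((3 : ℝ) / 2) ≤ (E.ncard : ℝ) →
          ∀ (a b : F), a ≠ 0 → b ≠ 0 →
            |(Set.ncard {t : (Fin 2 → F) × (Fin 2 → F) × (Fin 2 → F) |
                  t.1 ∈ E ∧ t.2.1 ∈ E ∧ t.2.2 ∈ E ∧
                  fnorm (t.1 - t.2.1) = a ∧ fnorm (t.1 - t.2.2) = b} : ℝ) -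
                (E.ncard : ℝ) ^ 3 / (Fintype.card F : ℝ) ^ 2| ≤
              ε * (E.ncard : ℝ) ^ 3 / (Fintype.card F : ℝ) ^ 2 := by
  refine ⟨1 + 24 / ε, by positivity, ?_⟩
  intro F _ _ hq E hE a b ha hb
  obtain ⟨E, rfl⟩ := (Set.toFinite E).exists_finset_coe
  rw [Set.ncard_coe_finset] at hE ⊢
  have hK : 1 ≤ 1 + 24 / ε := by
    have : 0 < 24 / ε := by positivity
    linarith
  have h := hg_final hq E a b ha hb _ hK hE
  rw [hg_count, mul_div_assoc]
  refine le_trans h ?_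
  apply mul_le_mul_of_nonneg_right _ (by positivity)
  rw [div_le_iff₀ (by positivity)]
  have : ε * (1 + 24 / ε) = ε + 24 := by field_simp
  rw [this]
  linarith
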